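/- arXiv:0805.1918 — 3 statements merged into one kernel-verified Lean document; each statement's English description precedes it below -/
import Mathlib

section
/- Let H_l be a super spherical harmonic of degree l. Then F^±_{m|2n}(H_l(x) · exp(x²/2))(y) = (±i)^l · H_l(y) · exp(y²/2), where H_l(y) denotes the same polynomial written in the y variables and exp(x²/2) = exp(−(x_1²+⋯+x_m²)/2)·Σ_{j=0}^n (x`²)^j/(2^j j!) with x`² = Σ_{j=1}^n x`_{2j−1} x`_{2j}. -/
open scoped BigOperators
open Finset MeasureTheory

noncomputable section

/-- The Grassmann algebra on `N` anticommuting generators with coefficients in a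
commutative ring `R`, represented by its coefficients with respect to the basis of
increasingly-ordered monomials, indexed by subsets of the generators. -/
abbrev Gr (R : Type) (N : ℕ) : Type := Finset (Fin N) → R

namespace Gr

variable {R : Type} [CommRing R] {N : ℕ}

/-- The sign produced when reordering the concatenation of the ordered monomials indexed
by `A` and `B` into the ordered monomial indexed by `A ∪ B`. -/
def msign (A B : Finset (Fin N)) : R :=
  (-1 : R) ^ (((A ×ˢ B).filter fun p => p.2 < p.1).card)

/-- Multiplication of the Grassmann algebra. -/
def mul (f g : Gr R N) : Gr R N :=
  fun s => ∑ A ∈ s.powerset, msign A (s \ A) * f A * g (s \ A)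

/-- The unit of the Grassmann algebra. -/
def one : Gr R N := fun s => if s = (∅ : Finset (Fin N)) then 1 else 0

/-- The `j`-th generator of the Grassmann algebra. -/
def gen (j : Fin N) : Gr R N := fun s => if s = {j} then 1 else 0

/-- Powers in the Grassmann algebra. -/
def pow (f : Gr R N) : ℕ → Gr R N
  | 0 => one
  | k + 1 => mul (pow f k) f

/-- The left partial derivative `∂_j`, i.e. the odd derivation with `∂_j(x_k) = δ_{jk}`. -/
def pderiv (j : Fin N) (f : Gr R N) : Gr R N :=
  fun s => if j ∈ s then 0
    else (-1 : R) ^ ((s.filter fun i => i < j).card) * f (insert j s)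

/-- The exponential of a Grassmann algebra element with nilpotent (zero-constant-term)
argument: the series terminates, and all terms beyond degree `N` vanish. -/
def gexp (f : Gr ℂ N) : Gr ℂ N :=
  ∑ k ∈ Finset.range (N + 1), ((k.factorial : ℂ))⁻¹ • pow f k

/-- Iterated left partial derivatives: the first element of the list acts first. -/
def derivList (l : List (Fin N)) (f : Gr R N) : Gr R N :=
  l.foldl (fun g j => pderiv j g) f

/-- Complex conjugation of the coefficients. -/
def gconj (f : Gr ℂ N) : Gr ℂ N := fun s => (starRingEnd ℂ) (f s)

end Gr

/-- The Lean index of the paper's generator `x`_{2j-1}` (j = 1,…,n). -/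
def lo (n : ℕ) (j : Fin n) : Fin (2 * n) := ⟨2 * (j : ℕ), by have := j.isLt; omega⟩

/-- The Lean index of the paper's generator `x`_{2j}` (j = 1,…,n). -/
def hi (n : ℕ) (j : Fin n) : Fin (2 * n) := ⟨2 * (j : ℕ) + 1, by have := j.isLt; omega⟩

/-- `x`² = Σ_{j=1}^n x`_{2j-1} x`_{2j}`. -/
def xsq (n : ℕ) : Gr ℂ (2 * n) := ∑ j : Fin n, Gr.mul (Gr.gen (lo n j)) (Gr.gen (hi n j))

/-- The fermionic Laplace operator `Δ_f = 4 Σ_{j=1}^n ∂_{x`_{2j-1}} ∂_{x`_{2j}}`. -/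
def lapF (n : ℕ) (f : Gr ℂ (2 * n)) : Gr ℂ (2 * n) :=
  (4 : ℂ) • ∑ j : Fin n, Gr.pderiv (lo n j) (Gr.pderiv (hi n j) f)

/-- The Berezin integral `∫_B = π^{-n} ∂_{x`_{2n}} ⋯ ∂_{x`_1}`. -/
def berezin (n : ℕ) (f : Gr ℂ (2 * n)) : ℂ :=
  ((Real.pi : ℂ) ^ n)⁻¹ * Gr.derivList (List.finRange (2 * n)) f ∅

/-- The fermionic Gaussian `exp(x`²/2) = Σ_{j=0}^n (x`²)^j/(2^j j!)`. -/
def fermGauss (n : ℕ) : Gr ℂ (2 * n) :=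
  ∑ j ∈ Finset.range (n + 1), (((2 : ℂ) ^ j * j.factorial)⁻¹) • Gr.pow (xsq n) j

/-- Embedding of the `x` generators into the Grassmann algebra on the `4n` generators
`x`_1, …, x`_{2n}, y`_1, …, y`_{2n}` (the `x` generators come first). -/
def xi (n : ℕ) (t : Fin (2 * n)) : Fin (2 * n + 2 * n) := Fin.castAdd (2 * n) t

/-- Embedding of the `y` generators into the Grassmann algebra on the `4n` generators. -/
def yi (n : ℕ) (t : Fin (2 * n)) : Fin (2 * n + 2 * n) := Fin.natAdd (2 * n) t

/-- The algebra embedding `Λ_{2n} → Λ_{4n}` sending the generators to the `x` generators. -/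
def embX (n : ℕ) (f : Gr ℂ (2 * n)) : Gr ℂ (2 * n + 2 * n) :=
  fun s => ∑ A : Finset (Fin (2 * n)), if s = A.image (xi n) then f A else 0

/-- The Berezin integral with respect to the `x` variables,
`π^{-n} ∂_{x`_{2n}} ⋯ ∂_{x`_1}`, inside the mixed algebra `Λ_{4n}`. -/
def berezinX (n : ℕ) (F : Gr ℂ (2 * n + 2 * n)) : Gr ℂ (2 * n + 2 * n) :=
  ((Real.pi : ℂ) ^ n)⁻¹ • Gr.derivList ((List.finRange (2 * n)).map (xi n)) F

/-- The fermionic Fourier kernel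
`K^σ(x, y) = exp(-σ (i/2) Σ_{j=1}^n (x`_{2j-1} y`_{2j} - x`_{2j} y`_{2j-1}))`
(for the plus sign `σ = 1`, for the minus sign `σ = -1`). -/
def fermK (n : ℕ) (σ : ℂ) : Gr ℂ (2 * n + 2 * n) :=
  Gr.gexp ((-σ * (Complex.I / 2)) • ∑ j : Fin n,
    (Gr.mul (Gr.gen (xi n (lo n j))) (Gr.gen (yi n (hi n j))) -
     Gr.mul (Gr.gen (xi n (hi n j))) (Gr.gen (yi n (lo n j)))))

/-- The fermionic Fourier transform
`F^σ_{0|2n}(g)(y) = (2π)^n ∫_{B,x} K^σ(x,y) g(x)`, an element of the Grassmann algebra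
in the `y` variables, identified with `Λ_{2n}`. -/
def fermFT (n : ℕ) (σ : ℂ) (g : Gr ℂ (2 * n)) : Gr ℂ (2 * n) :=
  fun s => (((2 * Real.pi : ℝ) : ℂ) ^ n) *
    berezinX n (Gr.mul (fermK n σ) (embX n g)) (s.image (yi n))


end
noncomputable section

/-- Functions on `ℝ^m` with values in the Grassmann algebra `Λ_{2n}`; the elements with
Schwartz coefficients form the space `S(ℝ^m)_{m|2n}`. -/
abbrev SF (m n : ℕ) : Type := ((Fin m) → ℝ) → Gr ℂ (2 * n)

/-- `f ∈ S(ℝ^m)_{m|2n}`: every Grassmann coefficient of `f` is a Schwartz function. -/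
def IsSchwartz (m n : ℕ) (f : SF m n) : Prop :=
  ∀ s : Finset (Fin (2 * n)), ∃ φ : SchwartzMap ((Fin m) → ℝ) ℂ, ∀ x, f x s = φ x

/-- The super Fourier transform
`F^σ_{m|2n}(f)(y) = (2π)^{-M/2} ∫_{ℝ^m} dV(x) ∫_{B,x} exp(σ i Σ_i x_i y_i) K^σ(x,y) f(x)`,
with `M = m - 2n` (plus sign: `σ = 1`; minus sign: `σ = -1`). -/
def superFT (m n : ℕ) (σ : ℂ) (f : SF m n) : SF m n :=
  fun y s => (((2 * Real.pi : ℝ) : ℂ) ^ ((-((m : ℂ) - 2 * (n : ℂ))) / 2)) *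
    ∫ x : (Fin m) → ℝ, Complex.exp (σ * Complex.I * ∑ i, (x i : ℂ) * (y i : ℂ)) *
      berezinX n (Gr.mul (fermK n σ) (embX n (f x))) (s.image (yi n))

/-- The partial derivative `∂_{x_i}` of a `Λ_{2n}`-valued function, acting coefficientwise. -/
def bderiv (m n : ℕ) (i : Fin m) (f : SF m n) : SF m n :=
  fun x s => fderiv ℝ (fun t => f t s) x (Pi.single i 1)

/-- The super Laplace operator `Δ = 4 Σ_j ∂_{x`_{2j-1}} ∂_{x`_{2j}} - Σ_j ∂_{x_j}²`. -/
def superLap (m n : ℕ) (f : SF m n) : SF m n :=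
  fun x => lapF n (f x) - ∑ i : Fin m, bderiv m n i (bderiv m n i f) x

/-- The element `x² = Σ_{j=1}^n x`_{2j-1} x`_{2j} - Σ_{j=1}^m x_j²` at the point `x`. -/
def xsqElem (m n : ℕ) (x : (Fin m) → ℝ) : Gr ℂ (2 * n) :=
  xsq n + (-(∑ i : Fin m, ((x i : ℂ)) ^ 2)) • Gr.one

/-- The super Gaussian `exp(x²/2) = exp(-(x_1²+⋯+x_m²)/2) Σ_{j=0}^n (x`²)^j/(2^j j!)`. -/
def gaussFun (m n : ℕ) : SF m n :=
  fun x => ((Real.exp (-(∑ i : Fin m, (x i) ^ 2) / 2) : ℝ) : ℂ) • fermGauss n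

/-- The Euler operator `𝔼 = Σ_j x_j ∂_{x_j} + Σ_j x`_j ∂_{x`_j}`. -/
def euler (m n : ℕ) (f : SF m n) : SF m n :=
  fun x => (∑ i : Fin m, ((x i : ℂ)) • bderiv m n i f x) +
    ∑ t : Fin (2 * n), Gr.mul (Gr.gen t) (Gr.pderiv t (f x))

/-- The super integral `∫_{ℝ^{m|2n}} f = ∫_{ℝ^m} dV(x) ∫_B f`. -/
def superInt (m n : ℕ) (f : SF m n) : ℂ := ∫ x : (Fin m) → ℝ, berezin n (f x)

end
noncomputable section

/-- Elements of `ℂ[x_1,…,x_m] ⊗ Λ_{2n}`: Grassmann elements whose coefficients are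
polynomials in the commuting variables. -/
abbrev PG (m n : ℕ) : Type := Gr (MvPolynomial (Fin m) ℂ) (2 * n)

/-- `H` is homogeneous of total degree `l`, counting both commuting and
anticommuting variables. -/
def PHomog (m n : ℕ) (H : PG m n) (l : ℕ) : Prop :=
  ∀ s : Finset (Fin (2 * n)), ∀ d ∈ (H s).support, (d.sum fun _ e => e) + s.card = l

/-- The super Laplace operator `Δ = 4 Σ_j ∂_{x`_{2j-1}} ∂_{x`_{2j}} - Σ_j ∂_{x_j}²`
on `ℂ[x_1,…,x_m] ⊗ Λ_{2n}`. -/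
def superLapP (m n : ℕ) (H : PG m n) : PG m n :=
  fun s => (4 : MvPolynomial (Fin m) ℂ) *
      (∑ j : Fin n, Gr.pderiv (lo n j) (Gr.pderiv (hi n j) H) s)
    - ∑ i : Fin m, MvPolynomial.pderiv i (MvPolynomial.pderiv i (H s))

/-- Evaluation of an element of `ℂ[x_1,…,x_m] ⊗ Λ_{2n}` at the point `x ∈ ℝ^m`,
giving a `Λ_{2n}`-valued function. -/
def evalP (m n : ℕ) (H : PG m n) : SF m n :=
  fun x s => MvPolynomial.eval (fun i => ((x i : ℝ) : ℂ)) (H s)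

end

namespace Gr

section Operators

variable {R : Type} [CommRing R] {N : ℕ}

/-- The sign picked up when moving the `j`-th generator past those of `s` preceding it. -/
def sgn (R : Type) [CommRing R] (j : Fin N) (s : Finset (Fin N)) : R :=
  (-1 : R) ^ ((s.filter fun i => i < j).card)

lemma sgn_mul_self (j : Fin N) (s : Finset (Fin N)) : sgn R j s * sgn R j s = 1 := by
  rw [sgn, ← mul_pow]; simp

lemma sgn_insert {i j : Fin N} {s : Finset (Fin N)} (h : i ∉ s) :
    sgn R j (insert i s) = (if i < j then -1 else 1) * sgn R j s := by
  unfold sgn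
  rw [Finset.filter_insert]
  split_ifs with hij
  · rw [Finset.card_insert_of_notMem (by simp [h]), pow_succ]; ring
  · simp

lemma sgn_insert_self (j : Fin N) (s : Finset (Fin N)) : sgn R j (insert j s) = sgn R j s := by
  simp [sgn, Finset.filter_insert]

lemma sgn_erase {i j : Fin N} {s : Finset (Fin N)} (h : i ∈ s) :
    sgn R j (s.erase i) = (if i < j then -1 else 1) * sgn R j s := by
  conv_rhs => rw [← Finset.insert_erase h, sgn_insert (Finset.notMem_erase i s)]
  split_ifs <;> ring

lemma sgn_erase_self (j : Fin N) (s : Finset (Fin N)) : sgn R j (s.erase j) = sgn R j s := by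
  by_cases h : j ∈ s
  · simp [sgn_erase h]
  · rw [Finset.erase_eq_of_notMem h]

/-- Left multiplication by the `j`-th generator, as a linear map. -/
def genL (j : Fin N) : Module.End R (Gr R N) where
  toFun f := fun s => if j ∈ s then sgn R j s * f (s.erase j) else 0
  map_add' f g := by ext s; simp only [Pi.add_apply]; split_ifs <;> ring
  map_smul' c f := by
    ext s; simp only [Pi.smul_apply, smul_eq_mul, RingHom.id_apply]; split_ifs <;> ring

lemma genL_apply (j : Fin N) (f : Gr R N) (s : Finset (Fin N)) :
    genL j f s = if j ∈ s then sgn R j s * f (s.erase j) else 0 := rfl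

/-- The partial derivative `∂_j`, as a linear map. -/
def pderivL (j : Fin N) : Module.End R (Gr R N) where
  toFun f := pderiv j f
  map_add' f g := by ext s; simp only [Pi.add_apply, pderiv]; split_ifs <;> ring
  map_smul' c f := by
    ext s; simp only [Pi.smul_apply, smul_eq_mul, RingHom.id_apply, pderiv]; split_ifs <;> ring

lemma pderivL_apply (j : Fin N) (f : Gr R N) (s : Finset (Fin N)) :
    pderivL j f s = if j ∈ s then 0 else sgn R j s * f (insert j s) := rfl

lemma pderivL_genL_self (j : Fin N) (f : Gr R N) :
    pderivL j (genL j f) + genL j (pderivL j f) = f := by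
  ext s
  simp only [Pi.add_apply, pderivL_apply, genL_apply]
  by_cases h : j ∈ s
  · simp [h, sgn_erase_self, ← mul_assoc, sgn_mul_self]
  · simp [h, sgn_insert_self, ← mul_assoc, sgn_mul_self]

lemma pderivL_genL_of_ne {j k : Fin N} (hjk : j ≠ k) (f : Gr R N) :
    pderivL j (genL k f) = - genL k (pderivL j f) := by
  ext s
  simp only [Pi.neg_apply, pderivL_apply, genL_apply]
  by_cases hj : j ∈ s
  · simp [hj, hjk]
  · by_cases hk : k ∈ s
    · rw [if_neg hj, if_pos (by simp [hk]), if_pos hk, if_neg (by simp [hj]), sgn_insert hj,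
        sgn_erase hk, Finset.erase_insert_of_ne hjk]
      rcases lt_or_gt_of_ne hjk with h | h
      · simp only [h, not_lt.2 h.le, if_true, if_false]; ring
      · simp only [h, not_lt.2 h.le, if_true, if_false]; ring
    · simp [hj, hk, hjk.symm]

lemma genL_genL {j k : Fin N} (hjk : j ≠ k) (f : Gr R N) :
    genL j (genL k f) = - genL k (genL j f) := by
  ext s
  simp only [Pi.neg_apply, genL_apply]
  by_cases hj : j ∈ s
  · by_cases hk : k ∈ s
    · rw [if_pos hj, if_pos (by simp [hk, hjk.symm]), if_pos hk, if_pos (by simp [hj, hjk]),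
        sgn_erase hj, sgn_erase hk, Finset.erase_right_comm]
      rcases lt_or_gt_of_ne hjk with h | h
      · simp only [h, not_lt.2 h.le, if_true, if_false]; ring
      · simp only [h, not_lt.2 h.le, if_true, if_false]; ring
    · simp [hk]
  · simp [hj]

lemma genL_genL_self (j : Fin N) (f : Gr R N) : genL j (genL j f) = 0 := by
  ext s; simp [genL_apply]

lemma pderivL_pderivL {j k : Fin N} (hjk : j ≠ k) (f : Gr R N) :
    pderivL j (pderivL k f) = - pderivL k (pderivL j f) := by
  ext s
  simp only [Pi.neg_apply, pderivL_apply]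
  by_cases hj : j ∈ s
  · simp [hj]
  · by_cases hk : k ∈ s
    · simp [hk]
    · rw [if_neg hj, if_neg (by simp [hk, hjk.symm]), if_neg hk, if_neg (by simp [hj, hjk]),
        sgn_insert hj, sgn_insert hk, Finset.insert_comm]
      rcases lt_or_gt_of_ne hjk with h | h
      · simp only [h, not_lt.2 h.le, if_true, if_false]; ring
      · simp only [h, not_lt.2 h.le, if_true, if_false]; ring

lemma pderivL_pderivL_self (j : Fin N) (f : Gr R N) : pderivL j (pderivL j f) = 0 := by
  ext s; simp [pderivL_apply]

lemma pderivL_comm_pair (t j k : Fin N) (f : Gr R N) :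
    pderivL t (pderivL j (pderivL k f)) = pderivL j (pderivL k (pderivL t f)) := by
  rcases eq_or_ne t j with rfl | htj
  · rcases eq_or_ne t k with rfl | htk
    · rfl
    · rw [pderivL_pderivL_self, pderivL_pderivL htk.symm, map_neg, pderivL_pderivL_self, neg_zero]
  · rcases eq_or_ne t k with rfl | htk
    · rw [pderivL_pderivL htj, pderivL_pderivL_self, map_zero, neg_zero]
    · rw [pderivL_pderivL htj, pderivL_pderivL htk, map_neg, neg_neg]

lemma genL_comm_pair (t j k : Fin N) (f : Gr R N) :
    genL t (genL j (genL k f)) = genL j (genL k (genL t f)) := by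
  rcases eq_or_ne t j with rfl | htj
  · rcases eq_or_ne t k with rfl | htk
    · rfl
    · rw [genL_genL_self, genL_genL htk.symm, map_neg, genL_genL_self, neg_zero]
  · rcases eq_or_ne t k with rfl | htk
    · rw [genL_genL htj, genL_genL_self, map_zero, neg_zero]
    · rw [genL_genL htj, genL_genL htk, map_neg, neg_neg]

lemma genL_pderivL_apply (j : Fin N) (f : Gr R N) (s : Finset (Fin N)) :
    genL j (pderivL j f) s = if j ∈ s then f s else 0 := by
  by_cases h : j ∈ s <;>
    simp [genL_apply, pderivL_apply, h, sgn_erase_self, ← mul_assoc, sgn_mul_self]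

lemma sum_genL_pderivL_apply (f : Gr R N) (s : Finset (Fin N)) :
    (∑ j, genL j (pderivL j f)) s = s.card * f s := by
  simp [Finset.sum_apply, genL_pderivL_apply]

lemma msign_union_left {A B : Finset (Fin N)} (h : Disjoint A B) (C : Finset (Fin N)) :
    (msign (A ∪ B) C : R) = msign A C * msign B C := by
  unfold msign
  rw [Finset.union_product, Finset.filter_union, Finset.card_union_of_disjoint, pow_add]
  exact Finset.disjoint_filter_filter (Finset.disjoint_product.2 (Or.inl h))

lemma msign_union_right {B C : Finset (Fin N)} (A : Finset (Fin N)) (h : Disjoint B C) :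
    (msign A (B ∪ C) : R) = msign A B * msign A C := by
  unfold msign
  rw [Finset.product_union, Finset.filter_union, Finset.card_union_of_disjoint, pow_add]
  exact Finset.disjoint_filter_filter (Finset.disjoint_product.2 (Or.inr h))

lemma mul_assoc' (f g h : Gr R N) : mul (mul f g) h = mul f (mul g h) := by
  ext s
  simp only [mul, Finset.sum_mul, Finset.mul_sum]
  rw [Finset.sum_sigma', Finset.sum_sigma']
  refine Finset.sum_bij' (fun p _ => ⟨p.2, p.1 \ p.2⟩) (fun p _ => ⟨p.1 ∪ p.2, p.1⟩) ?_ ?_ ?_ ?_ ?_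
  · rintro ⟨S, A⟩ hp
    simp only [Finset.mem_sigma, Finset.mem_powerset] at hp ⊢
    exact ⟨hp.2.trans hp.1, Finset.sdiff_subset_sdiff hp.1 le_rfl⟩
  · rintro ⟨A, B⟩ hp
    simp only [Finset.mem_sigma, Finset.mem_powerset] at hp ⊢
    exact ⟨Finset.union_subset hp.1 (hp.2.trans Finset.sdiff_subset), Finset.subset_union_left⟩
  · rintro ⟨S, A⟩ hp
    simp only [Finset.mem_sigma, Finset.mem_powerset] at hp
    simp [Finset.union_sdiff_of_subset hp.2]
  · rintro ⟨A, B⟩ hp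
    simp only [Finset.mem_sigma, Finset.mem_powerset] at hp
    have : Disjoint A B := (Finset.disjoint_of_subset_left hp.2 Finset.sdiff_disjoint).symm
    simp [Finset.union_sdiff_cancel_left this]
  · rintro ⟨S, A⟩ hp
    simp only [Finset.mem_sigma, Finset.mem_powerset] at hp
    obtain ⟨hS, hA⟩ := hp
    have e1 : (s \ A) \ (S \ A) = s \ S := by
      ext x; have := @hA x; simp only [Finset.mem_sdiff]; tauto
    have e2 : s \ A = (S \ A) ∪ (s \ S) := by
      ext x; have := @hA x; have := @hS x; simp only [Finset.mem_sdiff, Finset.mem_union]; tauto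
    have d1 : Disjoint A (S \ A) := Finset.disjoint_sdiff
    have d2 : Disjoint (S \ A) (s \ S) :=
      Finset.disjoint_of_subset_left Finset.sdiff_subset Finset.disjoint_sdiff
    simp only [e1]
    rw [e2, msign_union_right _ d2]
    conv_lhs => rw [← Finset.union_sdiff_of_subset hA, msign_union_left d1,
      Finset.union_sdiff_of_subset hA]
    ring

/-- Left multiplication in the Grassmann algebra, as a linear map. -/
def mulL : Gr R N →ₗ[R] Module.End R (Gr R N) :=
  LinearMap.mk₂ R mul
    (by intro f g h; ext s; simp [mul, ← Finset.sum_add_distrib]; congr! 1; ring)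
    (by intro c f g; ext s; simp [mul, Finset.mul_sum]; congr! 1; ring)
    (by intro f g h; ext s; simp [mul, ← Finset.sum_add_distrib]; congr! 1; ring)
    (by intro c f g; ext s; simp [mul, Finset.mul_sum]; congr! 1; ring)

lemma mulL_apply (f g : Gr R N) : mulL f g = mul f g := rfl

lemma mulL_mul (f g : Gr R N) : mulL (mul f g) = mulL f * mulL g := by
  exact LinearMap.ext fun h => mul_assoc' f g h

lemma mulL_one : mulL (one : Gr R N) = 1 := by
  ext f s
  simp [mulL_apply, mul, one, msign]

lemma mul_one' (f : Gr R N) : mul f one = f := by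
  ext s
  rw [mul, Finset.sum_eq_single s]
  · simp [one, msign]
  · intro A hA hne
    rw [Finset.mem_powerset] at hA
    have : s \ A ≠ ∅ := fun h => hne (hA.antisymm (Finset.sdiff_eq_empty_iff_subset.1 h))
    simp [one, this]
  · simp

lemma mulL_pow (f : Gr R N) (k : ℕ) : mulL (pow f k) = mulL f ^ k := by
  induction k with
  | zero => simp [pow, mulL_one]
  | succ k ih => rw [pow, mulL_mul, ih, pow_succ]

lemma msign_singleton (j : Fin N) (s : Finset (Fin N)) : (msign {j} s : R) = sgn R j s := by
  unfold msign sgn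
  congr 1
  rw [Finset.singleton_product, Finset.filter_map, Finset.card_map]
  rfl

lemma mulL_gen (j : Fin N) : mulL (gen j : Gr R N) = genL j := by
  refine LinearMap.ext fun f => ?_
  ext s
  rw [mulL_apply, mul, genL_apply]
  split_ifs with h
  · rw [Finset.sum_eq_single {j}]
    · rw [msign_singleton, Finset.sdiff_singleton_eq_erase, sgn_erase_self]; simp [gen]
    · intro A _ hA; simp [gen, hA]
    · simp [h]
  · refine Finset.sum_eq_zero fun A hA => ?_
    have : A ≠ {j} := by
      rintro rfl; simp at hA; exact h hA
    simp [gen, this]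

/-- Graded commutativity: elements supported in even degrees are central. -/
lemma mul_comm_of_even {f : Gr R N} (hf : ∀ s, ¬ Even s.card → f s = 0) (g : Gr R N) :
    mul g f = mul f g := by
  ext s
  unfold mul
  refine Finset.sum_bij' (fun A _ => s \ A) (fun A _ => s \ A) ?_ ?_ ?_ ?_ ?_
  · intro A _; simp
  · intro A _; simp
  · intro A hA; simpa using hA
  · intro A hA; simpa using hA
  · intro A hA
    rw [Finset.mem_powerset] at hA
    rw [Finset.sdiff_sdiff_eq_self hA]
    by_cases hev : Even (s \ A).card
    swap
    · simp [hf _ hev]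
    have : (msign A (s \ A) : R) = msign (s \ A) A := by
      have hd : Disjoint A (s \ A) := Finset.disjoint_sdiff
      have h1 : ((A ×ˢ (s \ A)).filter fun p => p.2 < p.1).card
          + (((s \ A) ×ˢ A).filter fun p => p.2 < p.1).card = A.card * (s \ A).card := by
        rw [← Finset.card_product, ← Finset.card_filter_add_card_filter_not (s := A ×ˢ (s \ A))
          (fun p => p.2 < p.1)]
        congr 1
        refine Finset.card_bij' (fun p _ => p.swap) (fun p _ => p.swap) ?_ ?_ ?_ ?_
        · rintro ⟨a, b⟩ h
          simp only [Finset.mem_filter, Finset.mem_product] at h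
          simp only [Prod.swap_prod_mk, Finset.mem_filter, Finset.mem_product, not_lt]
          exact ⟨h.1.symm, h.2.le⟩
        · rintro ⟨a, b⟩ h
          simp only [Finset.mem_filter, Finset.mem_product] at h
          have hne : b ≠ a := fun e => Finset.disjoint_left.1 hd h.1.1 (e ▸ h.1.2)
          simp only [Prod.swap_prod_mk, Finset.mem_filter, Finset.mem_product]
          exact ⟨h.1.symm, lt_of_le_of_ne (not_lt.1 h.2) hne.symm⟩
        · intros; rfl
        · intros; rfl
      have h2 : Even (((A ×ˢ (s \ A)).filter fun p => p.2 < p.1).card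
          + (((s \ A) ×ˢ A).filter fun p => p.2 < p.1).card) := by
        rw [h1]; exact hev.mul_left _
      unfold msign
      rw [Nat.even_add] at h2
      by_cases h3 : Even ((A ×ˢ (s \ A)).filter fun p => p.2 < p.1).card
      · rw [h3.neg_one_pow, (h2.1 h3).neg_one_pow]
      · rw [(Nat.not_even_iff_odd.1 h3).neg_one_pow,
          (Nat.not_even_iff_odd.1 (fun h => h3 (h2.2 h))).neg_one_pow]
    rw [this]; ring

lemma mul_apply_eq_zero {f g : Gr R N} {a b : ℕ} (hf : ∀ s, s.card ≠ a → f s = 0)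
    (hg : ∀ s, s.card ≠ b → g s = 0) (s : Finset (Fin N)) (hs : s.card ≠ a + b) :
    mul f g s = 0 := by
  refine Finset.sum_eq_zero fun A hA => ?_
  by_cases h : A.card = a
  · rw [hg (s \ A), mul_zero]
    rw [Finset.mem_powerset] at hA
    have := Finset.card_sdiff_add_card_eq_card hA
    omega
  · rw [hf A h]; simp

lemma pow_apply_eq_zero {f : Gr R N} (hf : ∀ s, s.card ≠ 2 → f s = 0) (k : ℕ)
    (s : Finset (Fin N)) (hs : s.card ≠ 2 * k) : pow f k s = 0 := by
  induction k generalizing s with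
  | zero => have : s ≠ ∅ := by rintro rfl; simp at hs
            simp [pow, one, this]
  | succ k ih => exact mul_apply_eq_zero ih hf s (by omega)

lemma gen_apply_eq_zero (j : Fin N) (s : Finset (Fin N)) (hs : s.card ≠ 1) :
    (gen j : Gr R N) s = 0 := by
  have : s ≠ {j} := by rintro rfl; simp at hs
  simp [gen, this]

end Operators

end Gr

namespace Gr

section Exponential

/-- Commuting a derivation `D` past a truncated exponential series in `Q`, when the commutator
`W = [D, Q]` is central with respect to `Q` and annihilates the last term. -/
lemma commutator_truncated_exp {A : Type} [Ring A] [Algebra ℂ A] {D Q W : A} {T : ℕ}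
    (h : D * Q = Q * D + W) (hc : Commute W Q) (hz : W * Q ^ T = 0) :
    D * (∑ k ∈ Finset.range (T + 1), ((k.factorial : ℂ))⁻¹ • Q ^ k)
      = (∑ k ∈ Finset.range (T + 1), ((k.factorial : ℂ))⁻¹ • Q ^ k) * D
        + W * ∑ k ∈ Finset.range (T + 1), ((k.factorial : ℂ))⁻¹ • Q ^ k := by
  have hpow : ∀ k : ℕ, D * Q ^ (k + 1) = Q ^ (k + 1) * D + ((k + 1 : ℕ) : ℂ) • (W * Q ^ k) := by
    intro k
    induction k with
    | zero => simp [h]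
    | succ k ih =>
      have e : Q ^ (k + 1) * W = W * Q ^ (k + 1) := ((hc.pow_right (k + 1)).eq).symm
      rw [pow_succ Q (k + 1), ← mul_assoc, ih, add_mul, mul_assoc _ D Q, h, mul_add, e,
        smul_mul_assoc, mul_assoc W, ← pow_succ]
      push_cast
      rw [add_smul ((k : ℂ) + 1) 1, one_smul, ← mul_assoc]
      abel
  have hlast : W * (∑ k ∈ Finset.range (T + 1), ((k.factorial : ℂ))⁻¹ • Q ^ k)
      = ∑ k ∈ Finset.range T, ((k.factorial : ℂ))⁻¹ • (W * Q ^ k) := by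
    rw [Finset.sum_range_succ, mul_add, mul_smul_comm, hz, smul_zero, add_zero, Finset.mul_sum]
    simp_rw [mul_smul_comm]
  rw [hlast, Finset.sum_range_succ', mul_add, add_mul, Finset.mul_sum, Finset.sum_mul]
  simp_rw [mul_smul_comm, smul_mul_assoc, hpow, smul_add, Finset.sum_add_distrib, smul_smul]
  have hfac : ∀ k : ℕ, (((k + 1).factorial : ℂ))⁻¹ * ((k + 1 : ℕ) : ℂ)
      = ((k.factorial : ℂ))⁻¹ := by
    intro k
    have h1 : ((k + 1 : ℕ) : ℂ) ≠ 0 := by exact_mod_cast k.succ_ne_zero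
    have h2 : (k.factorial : ℂ) ≠ 0 := by exact_mod_cast k.factorial_ne_zero
    rw [Nat.factorial_succ, Nat.cast_mul]
    field_simp
  simp_rw [hfac]
  simp only [pow_zero, mul_one, one_mul]
  abel

variable {N : ℕ}

/-- The exponential series of `q` truncated after the term of order `T`. -/
noncomputable def truncExp (T : ℕ) (q : Gr ℂ N) : Gr ℂ N :=
  ∑ k ∈ Finset.range (T + 1), ((k.factorial : ℂ))⁻¹ • pow q k

lemma mulL_truncExp (T : ℕ) (q : Gr ℂ N) :
    mulL (truncExp T q) = ∑ k ∈ Finset.range (T + 1), ((k.factorial : ℂ))⁻¹ • mulL q ^ k := by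
  simp [truncExp, mulL_pow]

lemma commute_mulL_truncExp (T : ℕ) {q : Gr ℂ N} {B : Module.End ℂ (Gr ℂ N)}
    (h : Commute B (mulL q)) : Commute B (mulL (truncExp T q)) := by
  rw [mulL_truncExp]
  exact Commute.sum_right _ _ _ fun k _ => (h.pow_right k).smul_right _

lemma pderivL_truncExp {T : ℕ} {q : Gr ℂ N} (hT : N < 2 * T + 1)
    (hq : ∀ s, s.card ≠ 2 → q s = 0) {j t : Fin N} {c : ℂ}
    (h : pderivL j * mulL q = mulL q * pderivL j + c • genL t)
    (hc : Commute (genL t) (mulL q)) (f : Gr ℂ N) :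
    pderivL j (mulL (truncExp T q) f)
      = mulL (truncExp T q) (pderivL j f) + c • genL t (mulL (truncExp T q) f) := by
  have hz : (c • genL t : Module.End ℂ (Gr ℂ N)) * mulL q ^ T = 0 := by
    rw [← mulL_gen, ← mulL_pow, smul_mul_assoc, ← mulL_mul]
    suffices h0 : mul (gen t) (pow q T) = 0 by rw [h0]; simp
    ext s
    refine mul_apply_eq_zero (gen_apply_eq_zero t) (pow_apply_eq_zero hq T) s ?_
    have := s.card_le_univ
    rw [Fintype.card_fin] at this
    omega
  have := commutator_truncated_exp h (hc.smul_left c) hz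
  rw [← mulL_truncExp] at this
  simpa using LinearMap.congr_fun this f

lemma truncExp_apply_empty (T : ℕ) {q : Gr ℂ N} (hq : ∀ s, s.card ≠ 2 → q s = 0) :
    truncExp T q ∅ = 1 := by
  rw [truncExp, Finset.sum_apply, Finset.sum_eq_single 0]
  · simp [pow, one]
  · intro k _ hk
    rw [Pi.smul_apply, pow_apply_eq_zero hq k ∅ (by simp; omega), smul_zero]
  · simp

lemma truncExp_even (T : ℕ) {q : Gr ℂ N} (hq : ∀ s, s.card ≠ 2 → q s = 0)
    (s : Finset (Fin N)) (hs : ¬ Even s.card) : truncExp T q s = 0 := by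
  rw [truncExp, Finset.sum_apply]
  refine Finset.sum_eq_zero fun k _ => ?_
  rw [Pi.smul_apply, pow_apply_eq_zero hq k s (by rintro h; exact hs ⟨k, by omega⟩), smul_zero]

lemma pow_smul' (c : ℂ) (f : Gr ℂ N) (k : ℕ) : pow (c • f) k = c ^ k • pow f k := by
  have e : ∀ f : Gr ℂ N, pow f k = (mulL f ^ k) one := by
    intro f
    rw [← mulL_pow, mulL_apply, mul_one']
  rw [e, e, map_smul, smul_pow, LinearMap.smul_apply]

lemma pderivL_genL (j t : Fin N) (f : Gr ℂ N) :
    pderivL j (genL t f) = (if j = t then f else 0) - genL t (pderivL j f) := by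
  split_ifs with h
  · subst h
    rw [eq_sub_iff_add_eq, pderivL_genL_self]
  · rw [pderivL_genL_of_ne h, zero_sub]

lemma pderivL_genL_genL (j a b : Fin N) (f : Gr ℂ N) :
    pderivL j (genL a (genL b f)) = genL a (genL b (pderivL j f))
      + ((if j = a then genL b f else 0) - (if j = b then genL a f else 0)) := by
  rw [pderivL_genL, pderivL_genL, map_sub, apply_ite (genL a), map_zero]
  split_ifs <;> abel

lemma gen_mul_gen_apply_eq_zero (a b : Fin N) (s : Finset (Fin N)) (hs : s.card ≠ 2) :
    mul (gen a : Gr ℂ N) (gen b) s = 0 :=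
  mul_apply_eq_zero (gen_apply_eq_zero a) (gen_apply_eq_zero b) s hs

lemma commute_genL_pair (t a b : Fin N) :
    Commute (genL t) (mulL (mul (gen a) (gen b)) : Module.End ℂ (Gr ℂ N)) := by
  rw [mulL_mul, mulL_gen, mulL_gen]
  exact LinearMap.ext fun f => genL_comm_pair t a b f

end Exponential

end Gr

section FermionicGaussian

open Gr

variable {n : ℕ}

lemma lo_inj {j k : Fin n} : lo n j = lo n k ↔ j = k := by
  simp [lo, Fin.ext_iff]

lemma hi_inj {j k : Fin n} : hi n j = hi n k ↔ j = k := by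
  simp [hi, Fin.ext_iff]

lemma lo_ne_hi (j k : Fin n) : lo n j ≠ hi n k := by
  simp only [lo, hi, ne_eq, Fin.ext_iff]; omega

lemma sum_lo_hi {M : Type} [AddCommMonoid M] (f : Fin (2 * n) → M) :
    ∑ t, f t = ∑ j, (f (lo n j) + f (hi n j)) := by
  rw [← Equiv.sum_comp ((finProdFinEquiv (m := n) (n := 2)).trans (finCongr (Nat.mul_comm n 2))),
    Fintype.sum_prod_type]
  refine Finset.sum_congr rfl fun j _ => ?_
  rw [Fin.sum_univ_two]
  congr 2
  · ext; simp [lo]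
  · ext; simp [hi, add_comm]

lemma xsq_apply_eq_zero (s : Finset (Fin (2 * n))) (hs : s.card ≠ 2) : xsq n s = 0 := by
  rw [xsq, Finset.sum_apply]
  exact Finset.sum_eq_zero fun j _ => gen_mul_gen_apply_eq_zero _ _ s hs

lemma fermGauss_eq : fermGauss n = truncExp n ((1 / 2 : ℂ) • xsq n) := by
  unfold fermGauss truncExp
  refine Finset.sum_congr rfl fun k _ => ?_
  rw [pow_smul', smul_smul]
  congr 1
  rw [mul_inv, one_div, inv_pow, mul_comm]

lemma half_xsq_apply_eq_zero (s : Finset (Fin (2 * n))) (hs : s.card ≠ 2) :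
    ((1 / 2 : ℂ) • xsq n) s = 0 := by
  rw [Pi.smul_apply, xsq_apply_eq_zero s hs, smul_zero]

lemma mul_fermGauss (g : Gr ℂ (2 * n)) : mul g (fermGauss n) = mulL (fermGauss n) g := by
  rw [mulL_apply]
  refine mul_comm_of_even ?_ g
  rw [fermGauss_eq]
  exact truncExp_even n half_xsq_apply_eq_zero

lemma commute_genL_half_xsq (t : Fin (2 * n)) :
    Commute (genL t) (mulL ((1 / 2 : ℂ) • xsq n)) := by
  rw [map_smul, xsq, map_sum]
  exact (Commute.sum_right _ _ _ fun j _ => commute_genL_pair t _ _).smul_right _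

lemma genL_fermGauss (t : Fin (2 * n)) (g : Gr ℂ (2 * n)) :
    genL t (mulL (fermGauss n) g) = mulL (fermGauss n) (genL t g) := by
  rw [fermGauss_eq]
  exact LinearMap.congr_fun (commute_mulL_truncExp n (commute_genL_half_xsq t)) g

lemma pderivL_lo_fermGauss (k : Fin n) (g : Gr ℂ (2 * n)) :
    pderivL (lo n k) (mulL (fermGauss n) g)
      = mulL (fermGauss n) (pderivL (lo n k) g)
        + (1 / 2 : ℂ) • genL (hi n k) (mulL (fermGauss n) g) := by
  rw [fermGauss_eq]
  refine pderivL_truncExp (by omega) half_xsq_apply_eq_zero (LinearMap.ext fun f => ?_)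
    (commute_genL_half_xsq _) g
  simp [xsq, mulL_mul, mulL_gen, LinearMap.sum_apply, pderivL_genL_genL, lo_inj, lo_ne_hi,
    Finset.sum_add_distrib]

lemma pderivL_hi_fermGauss (k : Fin n) (g : Gr ℂ (2 * n)) :
    pderivL (hi n k) (mulL (fermGauss n) g)
      = mulL (fermGauss n) (pderivL (hi n k) g)
        + (-(1 / 2) : ℂ) • genL (lo n k) (mulL (fermGauss n) g) := by
  rw [fermGauss_eq]
  refine pderivL_truncExp (by omega) half_xsq_apply_eq_zero (LinearMap.ext fun f => ?_)
    (commute_genL_half_xsq _) g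
  simp [xsq, mulL_mul, mulL_gen, LinearMap.sum_apply, pderivL_genL_genL, hi_inj,
    (lo_ne_hi _ _).symm, Finset.sum_add_distrib, sub_eq_add_neg]

/-- Adding an adjacent pair of generators halves the coefficient of the fermionic Gaussian. -/
lemma fermGauss_insert (k : Fin n) {s : Finset (Fin (2 * n))} (h1 : lo n k ∉ s)
    (h2 : hi n k ∉ s) :
    fermGauss n (insert (lo n k) (insert (hi n k) s)) = (1 / 2) * fermGauss n s := by
  have h := congrFun (pderivL_lo_fermGauss k one) (insert (hi n k) s)
  have h0 : pderivL (lo n k) (one : Gr ℂ (2 * n)) = 0 := by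
    ext t; simp [pderivL_apply, one]
  rw [h0, map_zero, zero_add, mulL_apply, mul_one', pderivL_apply, Pi.smul_apply, genL_apply,
    if_neg (by simp [h1, lo_ne_hi]), if_pos (by simp), Finset.erase_insert h2, sgn_insert h2,
    if_neg (by simp [lo, hi, Fin.lt_def]), one_mul, sgn_insert_self] at h
  have e : sgn ℂ (hi n k) s = sgn ℂ (lo n k) s := by
    unfold sgn
    congr 2
    refine Finset.filter_congr fun i hi' => ?_
    have : i ≠ lo n k := fun e => h1 (e ▸ hi')
    simp only [lo, hi, Fin.lt_def, ne_eq, Fin.ext_iff] at this ⊢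
    omega
  rw [e] at h
  have hs := sgn_mul_self (R := ℂ) (lo n k) s
  calc _ = sgn ℂ (lo n k) s * (sgn ℂ (lo n k) s
        * fermGauss n (insert (lo n k) (insert (hi n k) s))) := by
          rw [← mul_assoc, hs, one_mul]
    _ = _ := by
      rw [h, smul_eq_mul]
      linear_combination (1 / 2 * fermGauss n s) * hs

lemma fermGauss_univ : fermGauss n Finset.univ = (1 / 2) ^ n := by
  have key : ∀ k : ℕ, k ≤ n →
      fermGauss n (Finset.univ.filter fun i : Fin (2 * n) => (i : ℕ) < 2 * k) = (1 / 2) ^ k := by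
    intro k
    induction k with
    | zero =>
      intro _
      have : (Finset.univ.filter fun i : Fin (2 * n) => (i : ℕ) < 2 * 0) = ∅ := by ext; simp
      rw [this, fermGauss_eq, truncExp_apply_empty n half_xsq_apply_eq_zero, pow_zero]
    | succ k ih =>
      intro hk
      have e : (Finset.univ.filter fun i : Fin (2 * n) => (i : ℕ) < 2 * (k + 1))
          = insert (lo n ⟨k, hk⟩) (insert (hi n ⟨k, hk⟩)
            (Finset.univ.filter fun i : Fin (2 * n) => (i : ℕ) < 2 * k)) := by
        ext i
        simp only [Finset.mem_filter, Finset.mem_univ, true_and, Finset.mem_insert, lo, hi,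
          Fin.ext_iff]
        omega
      rw [e, fermGauss_insert, ih (by omega), pow_succ]
      · ring
      · simp [lo]
      · simp [hi]
  have := key n le_rfl
  rwa [Finset.filter_true_of_mem (fun i _ => i.isLt)] at this

end FermionicGaussian

section MixedAlgebra

open Gr

variable {n : ℕ}

lemma xi_injective : Function.Injective (xi n) := Fin.castAdd_injective _ _

lemma yi_injective : Function.Injective (yi n) := Fin.natAdd_injective _ _

lemma xi_ne_yi (j k : Fin (2 * n)) : xi n j ≠ yi n k := by
  have := j.isLt
  simp only [xi, yi, ne_eq, Fin.ext_iff, Fin.val_castAdd, Fin.val_natAdd]; omega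

lemma xi_mem_image_xi {k : Fin (2 * n)} {A : Finset (Fin (2 * n))} :
    xi n k ∈ A.image (xi n) ↔ k ∈ A :=
  xi_injective.mem_finset_image

lemma yi_mem_image_yi {k : Fin (2 * n)} {A : Finset (Fin (2 * n))} :
    yi n k ∈ A.image (yi n) ↔ k ∈ A :=
  yi_injective.mem_finset_image

lemma xi_notMem_image_yi (k : Fin (2 * n)) (A : Finset (Fin (2 * n))) :
    xi n k ∉ A.image (yi n) := by
  simp [(xi_ne_yi _ _).symm]

lemma yi_notMem_image_xi (k : Fin (2 * n)) (A : Finset (Fin (2 * n))) :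
    yi n k ∉ A.image (xi n) := by
  simp [xi_ne_yi]

lemma embX_image (f : Gr ℂ (2 * n)) (A : Finset (Fin (2 * n))) :
    embX n f (A.image (xi n)) = f A := by
  simp [embX, (Finset.image_injective (xi_injective (n := n))).eq_iff]

lemma embX_of_forall_ne (f : Gr ℂ (2 * n)) {s : Finset (Fin (2 * n + 2 * n))}
    (h : ∀ A : Finset (Fin (2 * n)), s ≠ A.image (xi n)) : embX n f s = 0 := by
  simp [embX, h]

/-- The embedding `embX` as a linear map. -/
def embXL (n : ℕ) : Gr ℂ (2 * n) →ₗ[ℂ] Gr ℂ (2 * n + 2 * n) where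
  toFun := embX n
  map_add' f g := by
    ext s
    simp only [embX, Pi.add_apply, ← Finset.sum_add_distrib]
    exact Finset.sum_congr rfl fun A _ => by split_ifs <;> simp
  map_smul' c f := by
    ext s
    simp only [embX, Pi.smul_apply, smul_eq_mul, RingHom.id_apply, Finset.mul_sum]
    exact Finset.sum_congr rfl fun A _ => by split_ifs <;> simp

lemma embXL_apply (f : Gr ℂ (2 * n)) : embXL n f = embX n f := rfl

lemma sgn_xi (k : Fin (2 * n)) (A : Finset (Fin (2 * n))) :
    sgn ℂ (xi n k) (A.image (xi n)) = sgn ℂ k A := by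
  unfold sgn
  rw [Finset.filter_image, Finset.card_image_of_injective _ xi_injective]
  rfl

lemma pderivL_xi_embX (k : Fin (2 * n)) (f : Gr ℂ (2 * n)) :
    pderivL (xi n k) (embXL n f) = embXL n (pderivL k f) := by
  ext s
  simp only [embXL_apply, pderivL_apply]
  by_cases h : ∃ A : Finset (Fin (2 * n)), s = A.image (xi n)
  · obtain ⟨A, rfl⟩ := h
    rw [embX_image, pderivL_apply, ← Finset.image_insert, embX_image, sgn_xi]
    simp only [xi_mem_image_xi]
  · push Not at h
    rw [embX_of_forall_ne _ h]
    split_ifs with hk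
    · rfl
    · rw [embX_of_forall_ne, mul_zero]
      intro A hA
      refine h (A.erase k) ?_
      rw [Finset.image_erase xi_injective, ← hA, Finset.erase_insert hk]

lemma genL_xi_embX (k : Fin (2 * n)) (f : Gr ℂ (2 * n)) :
    genL (xi n k) (embXL n f) = embXL n (genL k f) := by
  ext s
  simp only [embXL_apply, genL_apply]
  by_cases h : ∃ A : Finset (Fin (2 * n)), s = A.image (xi n)
  · obtain ⟨A, rfl⟩ := h
    rw [embX_image, genL_apply, ← Finset.image_erase xi_injective, embX_image, sgn_xi]
    simp only [xi_mem_image_xi]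
  · push Not at h
    rw [embX_of_forall_ne _ h]
    split_ifs with hk
    · rw [embX_of_forall_ne, mul_zero]
      intro A hA
      refine h (insert k A) ?_
      rw [Finset.image_insert, ← hA, Finset.insert_erase hk]
    · rfl

lemma pderivL_yi_embX (k : Fin (2 * n)) (f : Gr ℂ (2 * n)) :
    pderivL (yi n k) (embXL n f) = 0 := by
  ext s
  rw [embXL_apply, pderivL_apply, Pi.zero_apply]
  split_ifs with hk
  · rfl
  · rw [embX_of_forall_ne, mul_zero]
    intro A hA
    exact yi_notMem_image_xi k A (hA ▸ Finset.mem_insert_self _ _)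

/-- The coefficient, as an element of the algebra in the `y` generators, of the top monomial in
the `x` generators. -/
def topX (n : ℕ) : Gr ℂ (2 * n + 2 * n) →ₗ[ℂ] Gr ℂ (2 * n) where
  toFun F := fun s => F (Finset.univ.image (xi n) ∪ s.image (yi n))
  map_add' _ _ := rfl
  map_smul' _ _ := rfl

lemma topX_apply (F : Gr ℂ (2 * n + 2 * n)) (s : Finset (Fin (2 * n))) :
    topX n F s = F (Finset.univ.image (xi n) ∪ s.image (yi n)) := rfl

lemma derivList_apply_of_sorted {N : ℕ} (l : List (Fin N)) (f : Gr ℂ N) (s : Finset (Fin N))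
    (hl : l.Pairwise (· < ·)) (hs : ∀ i ∈ l, ∀ j ∈ s, i < j) :
    derivList l f s = f (l.toFinset ∪ s) := by
  induction l generalizing f with
  | nil => simp [derivList]
  | cons a l ih =>
    rw [List.pairwise_cons] at hl
    have e : derivList (a :: l) f = derivList l (pderiv a f) := rfl
    have hlt : ∀ i ∈ l.toFinset ∪ s, a < i := by
      intro i hi
      rw [Finset.mem_union, List.mem_toFinset] at hi
      exact hi.elim (hl.1 i) (hs a (by simp) i)
    rw [e, ih _ hl.2 (fun i hi => hs i (by simp [hi])), pderiv,
      if_neg (fun h => (hlt a h).false), Finset.filter_false_of_mem (fun i hi => (hlt i hi).not_gt)]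
    simp

lemma berezinX_image (F : Gr ℂ (2 * n + 2 * n)) (s : Finset (Fin (2 * n))) :
    berezinX n F (s.image (yi n)) = ((Real.pi : ℂ) ^ n)⁻¹ * topX n F s := by
  rw [berezinX, Pi.smul_apply, smul_eq_mul, derivList_apply_of_sorted, topX_apply]
  · congr 3
  · rw [List.pairwise_map]
    exact (List.pairwise_lt_finRange _).imp fun h => h
  · intro i hi j hj
    simp only [List.mem_map, Finset.mem_image] at hi hj
    obtain ⟨a, _, rfl⟩ := hi
    obtain ⟨b, _, rfl⟩ := hj
    have := a.isLt
    simp only [xi, yi, Fin.lt_def, Fin.val_castAdd, Fin.val_natAdd]; omega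

lemma topX_pderivL_xi (k : Fin (2 * n)) (F : Gr ℂ (2 * n + 2 * n)) :
    topX n (pderivL (xi n k) F) = 0 := by
  ext s
  rw [topX_apply, pderivL_apply, if_pos (by simp)]
  rfl

lemma sgn_yi (k : Fin (2 * n)) (A : Finset (Fin (2 * n))) :
    sgn ℂ (yi n k) (Finset.univ.image (xi n) ∪ A.image (yi n)) = sgn ℂ k A := by
  unfold sgn
  have hd : Disjoint ((Finset.univ.image (xi n)).filter fun i => i < yi n k)
      ((A.image (yi n)).filter fun i => i < yi n k) := by
    refine Finset.disjoint_filter_filter (Finset.disjoint_left.2 fun i hi => ?_)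
    obtain ⟨a, _, rfl⟩ := Finset.mem_image.1 hi
    exact xi_notMem_image_yi a A
  have h1 : ((Finset.univ.image (xi n)).filter fun i => i < yi n k)
      = Finset.univ.image (xi n) := by
    refine Finset.filter_true_of_mem fun i hi => ?_
    obtain ⟨a, _, rfl⟩ := Finset.mem_image.1 hi
    have := a.isLt
    simp only [xi, yi, Fin.lt_def, Fin.val_castAdd, Fin.val_natAdd]; omega
  rw [Finset.filter_union, Finset.card_union_of_disjoint hd, h1,
    Finset.card_image_of_injective _ xi_injective, Finset.card_univ, Fintype.card_fin, pow_add,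
    Even.neg_one_pow (even_two_mul n), one_mul, Finset.filter_image,
    Finset.card_image_of_injective _ yi_injective]
  congr 3
  ext i
  simp [yi]

lemma topX_genL_yi (k : Fin (2 * n)) (F : Gr ℂ (2 * n + 2 * n)) :
    topX n (genL (yi n k) F) = genL k (topX n F) := by
  ext s
  have h : yi n k ∈ Finset.univ.image (xi n) ∪ s.image (yi n) ↔ k ∈ s := by
    rw [Finset.mem_union, yi_mem_image_yi, or_iff_right (yi_notMem_image_xi k _)]
  rw [topX_apply, genL_apply, genL_apply, topX_apply, sgn_yi, Finset.erase_union_distrib,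
    Finset.erase_eq_of_notMem (yi_notMem_image_xi k _), Finset.image_erase yi_injective]
  simp only [h]

lemma topX_pderivL_yi (k : Fin (2 * n)) (F : Gr ℂ (2 * n + 2 * n)) :
    topX n (pderivL (yi n k) F) = pderivL k (topX n F) := by
  ext s
  have h : yi n k ∈ Finset.univ.image (xi n) ∪ s.image (yi n) ↔ k ∈ s := by
    rw [Finset.mem_union, yi_mem_image_yi, or_iff_right (yi_notMem_image_xi k _)]
  rw [topX_apply, pderivL_apply, pderivL_apply, topX_apply, sgn_yi, Finset.image_insert,
    Finset.union_insert]
  simp only [h]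

/-- The exponent of the fermionic Fourier kernel. -/
noncomputable def kernelExp (n : ℕ) (σ : ℂ) : Gr ℂ (2 * n + 2 * n) :=
  (-σ * (Complex.I / 2)) • ∑ j : Fin n,
    (Gr.mul (Gr.gen (xi n (lo n j))) (Gr.gen (yi n (hi n j))) -
     Gr.mul (Gr.gen (xi n (hi n j))) (Gr.gen (yi n (lo n j))))

variable {σ : ℂ}

lemma fermK_eq : fermK n σ = truncExp (2 * n + 2 * n) (kernelExp n σ) := rfl

lemma kernelExp_apply_eq_zero (s : Finset (Fin (2 * n + 2 * n))) (hs : s.card ≠ 2) :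
    kernelExp n σ s = 0 := by
  rw [kernelExp, Pi.smul_apply, Finset.sum_apply, Finset.sum_eq_zero, smul_zero]
  intro j _
  rw [Pi.sub_apply, gen_mul_gen_apply_eq_zero _ _ s hs, gen_mul_gen_apply_eq_zero _ _ s hs,
    sub_zero]

lemma commute_genL_kernelExp (t : Fin (2 * n + 2 * n)) :
    Commute (genL t) (mulL (kernelExp n σ)) := by
  rw [kernelExp, map_smul, map_sum]
  refine (Commute.sum_right _ _ _ fun j _ => ?_).smul_right _
  rw [map_sub]
  exact (commute_genL_pair t _ _).sub_right (commute_genL_pair t _ _)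

lemma genL_fermK (t : Fin (2 * n + 2 * n)) (F : Gr ℂ (2 * n + 2 * n)) :
    genL t (mulL (fermK n σ) F) = mulL (fermK n σ) (genL t F) :=
  LinearMap.congr_fun (commute_mulL_truncExp _ (commute_genL_kernelExp t)) F

lemma pderivL_fermK {j t : Fin (2 * n + 2 * n)} {c : ℂ}
    (h : pderivL j * mulL (kernelExp n σ) = mulL (kernelExp n σ) * pderivL j + c • genL t)
    (F : Gr ℂ (2 * n + 2 * n)) :
    pderivL j (mulL (fermK n σ) F)
      = mulL (fermK n σ) (pderivL j F) + c • genL t (mulL (fermK n σ) F) := by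
  rw [fermK_eq]
  exact pderivL_truncExp (by omega) kernelExp_apply_eq_zero h (commute_genL_kernelExp _) F

lemma pderivL_xi_lo_fermK (k : Fin n) (F : Gr ℂ (2 * n + 2 * n)) :
    pderivL (xi n (lo n k)) (mulL (fermK n σ) F)
      = mulL (fermK n σ) (pderivL (xi n (lo n k)) F)
        + (-σ * (Complex.I / 2)) • genL (yi n (hi n k)) (mulL (fermK n σ) F) := by
  refine pderivL_fermK (LinearMap.ext fun f => ?_) F
  simp [kernelExp, mulL_mul, mulL_gen, LinearMap.sum_apply, pderivL_genL_genL, lo_inj, lo_ne_hi,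
    xi_injective.eq_iff, xi_ne_yi, Finset.sum_add_distrib, Finset.sum_sub_distrib]
  module

lemma pderivL_xi_hi_fermK (k : Fin n) (F : Gr ℂ (2 * n + 2 * n)) :
    pderivL (xi n (hi n k)) (mulL (fermK n σ) F)
      = mulL (fermK n σ) (pderivL (xi n (hi n k)) F)
        + (σ * (Complex.I / 2)) • genL (yi n (lo n k)) (mulL (fermK n σ) F) := by
  refine pderivL_fermK (LinearMap.ext fun f => ?_) F
  simp [kernelExp, mulL_mul, mulL_gen, LinearMap.sum_apply, pderivL_genL_genL, hi_inj,
    (lo_ne_hi _ _).symm, xi_injective.eq_iff, xi_ne_yi, Finset.sum_add_distrib,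
    Finset.sum_sub_distrib]
  module

lemma pderivL_yi_lo_fermK (k : Fin n) (F : Gr ℂ (2 * n + 2 * n)) :
    pderivL (yi n (lo n k)) (mulL (fermK n σ) F)
      = mulL (fermK n σ) (pderivL (yi n (lo n k)) F)
        + (-σ * (Complex.I / 2)) • genL (xi n (hi n k)) (mulL (fermK n σ) F) := by
  refine pderivL_fermK (LinearMap.ext fun f => ?_) F
  simp [kernelExp, mulL_mul, mulL_gen, LinearMap.sum_apply, pderivL_genL_genL, lo_inj, lo_ne_hi,
    yi_injective.eq_iff, (xi_ne_yi _ _).symm, Finset.sum_add_distrib, Finset.sum_sub_distrib]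
  module

lemma pderivL_yi_hi_fermK (k : Fin n) (F : Gr ℂ (2 * n + 2 * n)) :
    pderivL (yi n (hi n k)) (mulL (fermK n σ) F)
      = mulL (fermK n σ) (pderivL (yi n (hi n k)) F)
        + (σ * (Complex.I / 2)) • genL (xi n (lo n k)) (mulL (fermK n σ) F) := by
  refine pderivL_fermK (LinearMap.ext fun f => ?_) F
  simp [kernelExp, mulL_mul, mulL_gen, LinearMap.sum_apply, pderivL_genL_genL, hi_inj,
    (lo_ne_hi _ _).symm, yi_injective.eq_iff, (xi_ne_yi _ _).symm, Finset.sum_add_distrib,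
    Finset.sum_sub_distrib]
  module

/-- The fermionic Fourier transform of `g exp(x²/2)`, as a linear map in `g`. -/
noncomputable def fermFTGauss (n : ℕ) (σ : ℂ) : Module.End ℂ (Gr ℂ (2 * n)) :=
  (2 : ℂ) ^ n • (topX n ∘ₗ mulL (fermK n σ) ∘ₗ embXL n ∘ₗ mulL (fermGauss n))

lemma fermFTGauss_apply (g : Gr ℂ (2 * n)) :
    fermFTGauss n σ g
      = (2 : ℂ) ^ n • topX n (mulL (fermK n σ) (embXL n (mulL (fermGauss n) g))) := rfl

lemma fermFTGauss_genL_hi (k : Fin n) (g : Gr ℂ (2 * n)) :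
    fermFTGauss n σ (genL (hi n k) g) = (σ * Complex.I) • genL (hi n k) (fermFTGauss n σ g)
      - (2 : ℂ) • fermFTGauss n σ (pderivL (lo n k) g) := by
  have h := topX_pderivL_xi (lo n k) (mulL (fermK n σ) (embXL n (mulL (fermGauss n) g)))
  rw [pderivL_xi_lo_fermK, pderivL_xi_embX, pderivL_lo_fermGauss, genL_fermGauss] at h
  simp only [map_add, map_smul, topX_genL_yi] at h
  simp only [fermFTGauss_apply, map_smul]
  linear_combination (norm := module) ((2 : ℂ) ^ n * 2) • h

lemma fermFTGauss_genL_lo (k : Fin n) (g : Gr ℂ (2 * n)) :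
    fermFTGauss n σ (genL (lo n k) g) = (σ * Complex.I) • genL (lo n k) (fermFTGauss n σ g)
      + (2 : ℂ) • fermFTGauss n σ (pderivL (hi n k) g) := by
  have h := topX_pderivL_xi (hi n k) (mulL (fermK n σ) (embXL n (mulL (fermGauss n) g)))
  rw [pderivL_xi_hi_fermK, pderivL_xi_embX, pderivL_hi_fermGauss, genL_fermGauss] at h
  simp only [map_add, map_smul, topX_genL_yi] at h
  simp only [fermFTGauss_apply, map_smul]
  linear_combination (norm := module) (-(2 : ℂ) ^ n * 2) • h

lemma pderivL_lo_fermFTGauss (k : Fin n) (g : Gr ℂ (2 * n)) :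
    pderivL (lo n k) (fermFTGauss n σ g)
      = (-σ * (Complex.I / 2)) • fermFTGauss n σ (genL (hi n k) g) := by
  rw [fermFTGauss_apply, map_smul, ← topX_pderivL_yi, pderivL_yi_lo_fermK, pderivL_yi_embX,
    map_zero, zero_add, genL_fermK, genL_xi_embX, genL_fermGauss, map_smul, smul_comm]
  rfl

lemma pderivL_hi_fermFTGauss (k : Fin n) (g : Gr ℂ (2 * n)) :
    pderivL (hi n k) (fermFTGauss n σ g)
      = (σ * (Complex.I / 2)) • fermFTGauss n σ (genL (lo n k) g) := by
  rw [fermFTGauss_apply, map_smul, ← topX_pderivL_yi, pderivL_yi_hi_fermK, pderivL_yi_embX,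
    map_zero, zero_add, genL_fermK, genL_xi_embX, genL_fermGauss, map_smul, smul_comm]
  rfl

lemma pderivL_one {N : ℕ} (j : Fin N) : pderivL j (one : Gr ℂ N) = 0 := by
  ext t; simp [pderivL_apply, one]

/-- The `y`-free part of the Fourier kernel is `1`. -/
lemma fermK_image_xi (A : Finset (Fin (2 * n))) :
    fermK n σ (A.image (xi n)) = if A = ∅ then 1 else 0 := by
  split_ifs with h
  · subst h
    rw [Finset.image_empty, fermK_eq, truncExp_apply_empty _ kernelExp_apply_eq_zero]
  · obtain ⟨k, hk⟩ := Finset.nonempty_iff_ne_empty.2 h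
    have key : ∀ (t : Fin (2 * n)) (c : ℂ), pderivL (xi n k) (mulL (fermK n σ) one)
        = mulL (fermK n σ) (pderivL (xi n k) one) + c • genL (yi n t) (mulL (fermK n σ) one) →
        fermK n σ (A.image (xi n)) = 0 := by
      intro t c h1
      rw [pderivL_one, map_zero, zero_add, mulL_apply, mul_one'] at h1
      have h2 := congrFun h1 ((A.erase k).image (xi n))
      rw [pderivL_apply, Pi.smul_apply, genL_apply, if_neg (by rw [xi_mem_image_xi]; simp),
        if_neg (yi_notMem_image_xi _ _), smul_zero, ← Finset.image_insert,
        Finset.insert_erase hk] at h2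
      refine (mul_eq_zero.1 h2).resolve_left fun h3 => ?_
      have := sgn_mul_self (R := ℂ) (xi n k) ((A.erase k).image (xi n))
      rw [h3] at this
      simp at this
    obtain ⟨j, rfl | rfl⟩ : ∃ j, k = lo n j ∨ k = hi n j := by
      refine ⟨⟨k / 2, by have := k.isLt; omega⟩, ?_⟩
      simp only [lo, hi, Fin.ext_iff]; omega
    · exact key _ _ (pderivL_xi_lo_fermK j one)
    · exact key _ _ (pderivL_xi_hi_fermK j one)

lemma fermFTGauss_one_apply_empty : fermFTGauss n σ one ∅ = 1 := by
  rw [fermFTGauss_apply, mulL_apply (fermGauss n), mul_one', mulL_apply, Pi.smul_apply, topX_apply,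
    Finset.image_empty, Finset.union_empty, mul, Finset.sum_eq_single ∅]
  · have := fermK_image_xi (n := n) (σ := σ) ∅
    rw [Finset.image_empty, if_pos rfl] at this
    rw [this, Finset.sdiff_empty, embXL_apply, embX_image, fermGauss_univ]
    simp [msign]
  · intro A hA hne
    obtain ⟨B, _, rfl⟩ := Finset.subset_image_iff.1 (Finset.mem_powerset.1 hA)
    rw [fermK_image_xi, if_neg (by rintro rfl; simp at hne)]
    simp
  · simp

/-- An element of the Grassmann algebra is determined by its constant term and its derivatives,
when the latter are multiples of the element by generators. -/
lemma eq_of_pderivL_eq {N : ℕ} {f g : Gr ℂ N} (h0 : f ∅ = g ∅)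
    (h : ∀ j, ∃ (t : Fin N) (c : ℂ),
      pderivL j f = c • genL t f ∧ pderivL j g = c • genL t g) : f = g := by
  ext s
  induction hs : s.card using Nat.strong_induction_on generalizing s with
  | _ m ih =>
    rcases s.eq_empty_or_nonempty with rfl | ⟨j, hj⟩
    · exact h0
    · obtain ⟨t, c, hf, hg⟩ := h j
      have hf := congrFun hf (s.erase j)
      have hg := congrFun hg (s.erase j)
      have hlt : ((s.erase j).erase t).card < m := by
        have := Finset.card_erase_lt_of_mem hj
        have := Finset.card_le_card (Finset.erase_subset t (s.erase j))
        omega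
      have e := ih _ hlt _ rfl
      rw [pderivL_apply, if_neg (by simp), Finset.insert_erase hj, Pi.smul_apply, genL_apply]
        at hf hg
      rw [e, ← hg] at hf
      refine mul_left_cancel₀ (fun h3 => ?_) hf
      have := sgn_mul_self (R := ℂ) j (s.erase j)
      rw [h3] at this
      simp at this

lemma fermFTGauss_one (hσ : σ * σ = 1) : fermFTGauss n σ one = fermGauss n := by
  have hG : fermGauss n = mulL (fermGauss n) one := by rw [mulL_apply, mul_one']
  refine eq_of_pderivL_eq ?_ fun t => ?_
  · rw [fermFTGauss_one_apply_empty, fermGauss_eq, truncExp_apply_empty n half_xsq_apply_eq_zero]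
  · have hI : σ * (Complex.I / 2) * (σ * Complex.I) = -(1 / 2) := by
      linear_combination (-1 / 2 : ℂ) * hσ + σ * σ / 2 * Complex.I_mul_I
    obtain ⟨j, rfl | rfl⟩ : ∃ j, t = lo n j ∨ t = hi n j := by
      refine ⟨⟨t / 2, by have := t.isLt; omega⟩, ?_⟩
      simp only [lo, hi, Fin.ext_iff]; omega
    · refine ⟨hi n j, 1 / 2, ?_, ?_⟩
      · rw [pderivL_lo_fermFTGauss, fermFTGauss_genL_hi, pderivL_one, map_zero, smul_zero,
          sub_zero, smul_smul, neg_mul, neg_mul, hI, neg_neg]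
      · have := pderivL_lo_fermGauss j one
        rwa [pderivL_one, map_zero, zero_add, ← hG] at this
    · refine ⟨lo n j, -(1 / 2), ?_, ?_⟩
      · rw [pderivL_hi_fermFTGauss, fermFTGauss_genL_lo, pderivL_one, map_zero, smul_zero,
          add_zero, smul_smul, hI]
      · have := pderivL_hi_fermGauss j one
        rwa [pderivL_one, map_zero, zero_add, ← hG] at this

end MixedAlgebra

section BosonicGaussian

open MvPolynomial

variable {m : ℕ}

/-- The density `exp(-|x|²/2 + c·x)`. -/
noncomputable def gaussWeight (c : Fin m → ℂ) (x : Fin m → ℝ) : ℂ :=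
  Complex.exp (-(1 / 2) * ∑ i, (x i : ℂ) ^ 2 + ∑ i, c i * (x i : ℂ))

lemma integrable_pow_mul_cexp (k : ℕ) {c : ℂ} (hc : c.re = 0) :
    Integrable fun x : ℝ => (x : ℂ) ^ k * Complex.exp (-(1 / 2) * (x : ℂ) ^ 2 + c * x) := by
  have h := (integrable_rpow_mul_exp_neg_mul_sq (b := 1 / 2) (by norm_num) (s := k)
    (by have : (0 : ℝ) ≤ k := k.cast_nonneg
        linarith)).norm
  refine h.mono' (by fun_prop) (Filter.Eventually.of_forall fun x => le_of_eq ?_)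
  rw [norm_mul, norm_mul, norm_pow, Complex.norm_real, Complex.norm_exp, Real.rpow_natCast,
    norm_pow, Real.norm_eq_abs (Real.exp _), abs_of_pos (Real.exp_pos _)]
  congr 2
  have h2 : (-(1 / 2) * (x : ℂ) ^ 2 + c * x).re = -(1 / 2) * x ^ 2 + c.re * x := by
    have : (-(1 / 2) * (x : ℂ) ^ 2) = ((-(1 / 2) * x ^ 2 : ℝ) : ℂ) := by push_cast; ring
    rw [Complex.add_re, this, Complex.ofReal_re, Complex.re_mul_ofReal]
  rw [h2, hc]; ring

lemma integrable_eval_mul_gaussWeight {c : Fin m → ℂ} (hc : ∀ i, (c i).re = 0)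
    (p : MvPolynomial (Fin m) ℂ) :
    Integrable fun x : Fin m → ℝ => eval (fun i => (x i : ℂ)) p * gaussWeight c x := by
  induction p using MvPolynomial.induction_on' with
  | monomial d a =>
    have h := (Integrable.fintype_prod (f := fun i (v : ℝ) =>
      (v : ℂ) ^ (d i) * Complex.exp (-(1 / 2) * (v : ℂ) ^ 2 + c i * v))
      (fun i => integrable_pow_mul_cexp (d i) (hc i))).const_mul a
    refine h.congr (Filter.Eventually.of_forall fun x => ?_)
    simp only [eval_monomial, gaussWeight]
    rw [Finset.prod_mul_distrib, ← Complex.exp_sum, Finset.sum_add_distrib, ← Finset.mul_sum,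
      Finsupp.prod_fintype _ _ (by simp), mul_assoc]
  | add p q hp hq =>
    simp only [map_add, add_mul]
    exact hp.add hq

lemma hasLineDerivAt_eval (i : Fin m) (p : MvPolynomial (Fin m) ℂ) (x : Fin m → ℝ) :
    HasLineDerivAt ℝ (fun x : Fin m → ℝ => eval (fun i => (x i : ℂ)) p)
      (eval (fun i => (x i : ℂ)) (pderiv i p)) x (Pi.single i 1) := by
  induction p using MvPolynomial.induction_on with
  | C a => simpa [HasLineDerivAt] using hasDerivAt_const (0 : ℝ) a
  | add p q hp hq =>
    simp only [HasLineDerivAt, map_add] at hp hq ⊢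
    exact HasDerivAt.add hp hq
  | mul_X p j hp =>
    have hX : HasDerivAt (fun t : ℝ => (((x + t • (Pi.single i 1 : Fin m → ℝ)) j : ℝ) : ℂ))
        (((Pi.single i 1 : Fin m → ℝ) j : ℝ) : ℂ) 0 := by
      have h1 : HasDerivAt (fun t : ℝ => x j + t * (Pi.single i 1 : Fin m → ℝ) j)
          ((Pi.single i 1 : Fin m → ℝ) j) 0 := by
        simpa using ((hasDerivAt_id (0 : ℝ)).mul_const _).const_add (x j)
      exact h1.ofReal_comp
    have h := HasDerivAt.mul hp hX
    simp only [HasLineDerivAt, map_mul, eval_X]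
    refine HasDerivAt.congr_deriv h ?_
    rw [zero_smul, add_zero, Derivation.leibniz, pderiv_X]
    by_cases hij : j = i
    · subst hij; simp; ring
    · simp [hij, mul_comm]

lemma hasLineDerivAt_gaussWeight (c : Fin m → ℂ) (i : Fin m) (x : Fin m → ℝ) :
    HasLineDerivAt ℝ (gaussWeight c) ((c i - x i) * gaussWeight c x) x (Pi.single i 1) := by
  have h := hasLineDerivAt_eval i
    (C (-(1 / 2)) * ∑ j, X j ^ 2 + ∑ j, C (c j) * X j : MvPolynomial (Fin m) ℂ) x
  have h2 := HasDerivAt.cexp h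
  have he : ∀ z : Fin m → ℝ, eval (fun i => (z i : ℂ))
      (C (-(1 / 2)) * ∑ j, X j ^ 2 + ∑ j, C (c j) * X j : MvPolynomial (Fin m) ℂ) =
      -(1 / 2) * ∑ i, (z i : ℂ) ^ 2 + ∑ i, c i * (z i : ℂ) := by
    intro z; simp
  have hd : eval (fun i => (x i : ℂ)) (pderiv i
      (C (-(1 / 2)) * ∑ j, X j ^ 2 + ∑ j, C (c j) * X j : MvPolynomial (Fin m) ℂ)) =
      c i - x i := by
    simp [Derivation.leibniz, Derivation.leibniz_pow, pderiv_X, Pi.single_apply, mul_comm]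
    ring
  simp only [he, zero_smul, add_zero, hd] at h2
  exact HasDerivAt.congr_deriv h2 (mul_comm _ _)

/-- The normalized Gaussian integral of polynomials. -/
noncomputable def gaussFunctional (c : Fin m → ℂ) (p : MvPolynomial (Fin m) ℂ) : ℂ :=
  ((2 * Real.pi : ℝ) : ℂ) ^ (-(m : ℂ) / 2) * Complex.exp (-(∑ i, c i ^ 2) / 2) *
    ∫ x : Fin m → ℝ, eval (fun i => (x i : ℂ)) p * gaussWeight c x

lemma gaussFunctional_add {c : Fin m → ℂ} (hc : ∀ i, (c i).re = 0)
    (p q : MvPolynomial (Fin m) ℂ) :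
    gaussFunctional c (p + q) = gaussFunctional c p + gaussFunctional c q := by
  simp only [gaussFunctional, map_add, add_mul]
  rw [integral_add (integrable_eval_mul_gaussWeight hc p) (integrable_eval_mul_gaussWeight hc q)]
  ring

lemma gaussFunctional_C_mul (c : Fin m → ℂ) (a : ℂ) (p : MvPolynomial (Fin m) ℂ) :
    gaussFunctional c (C a * p) = a * gaussFunctional c p := by
  simp only [gaussFunctional, map_mul, eval_C, mul_assoc]
  rw [integral_const_mul]
  ring

/-- `gaussFunctional` as a linear map. -/
noncomputable def gaussFunctionalL {c : Fin m → ℂ} (hc : ∀ i, (c i).re = 0) :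
    MvPolynomial (Fin m) ℂ →ₗ[ℂ] ℂ where
  toFun := gaussFunctional c
  map_add' := gaussFunctional_add hc
  map_smul' a p := by
    rw [MvPolynomial.smul_eq_C_mul, gaussFunctional_C_mul]; rfl

lemma gaussFunctional_one (c : Fin m → ℂ) : gaussFunctional c 1 = 1 := by
  have h := GaussianFourier.integral_cexp_neg_mul_sum_add (b := 1 / 2) (by norm_num) c
  have hpi : (Real.pi : ℂ) / (1 / 2) = ((2 * Real.pi : ℝ) : ℂ) := by push_cast; ring
  have h0 : ((2 * Real.pi : ℝ) : ℂ) ≠ 0 := by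
    exact_mod_cast (by positivity : (2 * Real.pi : ℝ) ≠ 0)
  simp only [gaussFunctional, map_one, one_mul, gaussWeight]
  rw [h, hpi, Fintype.card_fin]
  have e1 : ((2 * Real.pi : ℝ) : ℂ) ^ (-(m : ℂ) / 2) * ((2 * Real.pi : ℝ) : ℂ) ^ ((m : ℂ) / 2)
      = 1 := by
    rw [← Complex.cpow_add _ _ h0, neg_div, neg_add_cancel, Complex.cpow_zero]
  have e2 : Complex.exp (-(∑ i, c i ^ 2) / 2) * Complex.exp ((∑ i, c i ^ 2) / (4 * (1 / 2)))
      = 1 := by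
    rw [← Complex.exp_add]
    have h2 : -(∑ i, c i ^ 2) / 2 + (∑ i, c i ^ 2) / (4 * (1 / 2)) = 0 := by ring
    rw [h2, Complex.exp_zero]
  linear_combination Complex.exp (-(∑ i, c i ^ 2) / 2)
    * Complex.exp ((∑ i, c i ^ 2) / (4 * (1 / 2))) * e1 + e2

/-- Integration by parts against the Gaussian weight. -/
lemma gaussFunctional_X_mul {c : Fin m → ℂ} (hc : ∀ i, (c i).re = 0) (i : Fin m)
    (p : MvPolynomial (Fin m) ℂ) :
    gaussFunctional c (X i * p) = c i * gaussFunctional c p + gaussFunctional c (pderiv i p) := by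
  have key : ∫ x : Fin m → ℝ,
      eval (fun i => (x i : ℂ)) (pderiv i p + C (c i) * p - X i * p) * gaussWeight c x = 0 := by
    have h := integral_bilinear_hasLineDerivAt_right_eq_neg_left_of_integrable
      (μ := (volume : Measure (Fin m → ℝ))) (B := ContinuousLinearMap.mul ℝ ℂ)
      (f := fun _ => (1 : ℂ)) (f' := fun _ => 0) (v := Pi.single i 1)
      (g := fun x : Fin m → ℝ => eval (fun i => (x i : ℂ)) p * gaussWeight c x)
      (g' := fun x : Fin m → ℝ =>
        eval (fun i => (x i : ℂ)) (pderiv i p + C (c i) * p - X i * p) * gaussWeight c x)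
      (by simp only [map_zero, zero_apply]; exact integrable_zero _ _ _)
      (by simpa only [ContinuousLinearMap.mul_apply', one_mul] using
          integrable_eval_mul_gaussWeight hc _)
      (by simpa only [ContinuousLinearMap.mul_apply', one_mul] using
          integrable_eval_mul_gaussWeight hc _)
      (fun x _ => hasDerivAt_const _ _)
      (fun x _ => by
        have := HasDerivAt.mul (hasLineDerivAt_eval i p x) (hasLineDerivAt_gaussWeight c i x)
        refine HasDerivAt.congr_deriv this ?_
        simp only [zero_smul, add_zero, map_add, map_sub, map_mul, eval_C, eval_X]
        ring)
    simpa only [ContinuousLinearMap.mul_apply', one_mul, zero_mul, integral_zero, neg_zero] using h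
  have h0 : gaussFunctionalL hc (pderiv i p + C (c i) * p - X i * p) = 0 := by
    change gaussFunctional c _ = 0
    rw [gaussFunctional, key, mul_zero]
  rw [map_sub, map_add] at h0
  have h1 : gaussFunctionalL hc (C (c i) * p) = c i * gaussFunctional c p :=
    gaussFunctional_C_mul c _ p
  change gaussFunctional c _ + gaussFunctionalL hc (C (c i) * p) - gaussFunctional c _ = 0 at h0
  rw [h1] at h0
  linear_combination -h0

end BosonicGaussian


namespace Gr

variable {R S : Type} [CommRing R] [CommRing S] {N : ℕ}

/-- The coefficientwise extension of an additive map to Grassmann algebras. -/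
def mapC (φ : R →+ S) : Gr R N →+ Gr S N where
  toFun f s := φ (f s)
  map_zero' := by ext s; simp
  map_add' f g := by ext s; simp

lemma mapC_apply (φ : R →+ S) (f : Gr R N) (s : Finset (Fin N)) : mapC φ f s = φ (f s) := rfl

lemma map_neg_one_pow_mul (φ : R →+ S) (k : ℕ) (r : R) :
    φ ((-1) ^ k * r) = (-1) ^ k * φ r := by
  rcases neg_one_pow_eq_or R k with h | h <;> rcases Nat.even_or_odd k with hk | hk <;>
    simp [hk.neg_one_pow]

lemma mapC_pderivL (φ : R →+ S) (j : Fin N) (f : Gr R N) :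
    mapC φ (pderivL j f) = pderivL j (mapC φ f) := by
  ext s
  simp only [mapC_apply, pderivL_apply, sgn]
  split_ifs
  · exact map_zero φ
  · exact map_neg_one_pow_mul φ _ _

lemma mapC_genL (φ : R →+ S) (j : Fin N) (f : Gr R N) :
    mapC φ (genL j f) = genL j (mapC φ f) := by
  ext s
  simp only [mapC_apply, genL_apply, sgn]
  split_ifs
  · exact map_neg_one_pow_mul φ _ _
  · exact map_zero φ

end Gr

section SphericalHarmonics

open MvPolynomial Gr

variable {m n : ℕ}

lemma MvPolynomial.pderiv_comm {τ R : Type*} [CommSemiring R] (i j : τ)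
    (p : MvPolynomial τ R) :
    pderiv i (pderiv j p) = pderiv j (pderiv i p) := by
  classical
  ext d
  simp only [coeff_pderiv]
  by_cases h : i = j
  · subst h; rfl
  · rw [add_right_comm]
    simp only [Finsupp.add_apply, Finsupp.single_apply, h, Ne.symm h, if_false, add_zero]
    ring

/-- The partial derivative `∂_{x_i}` acting coefficientwise. -/
noncomputable def pderivC (i : Fin m) : PG m n →+ PG m n :=
  mapC (MvPolynomial.pderiv i).toLinearMap.toAddMonoidHom

lemma pderivC_apply (i : Fin m) (H : PG m n) (s : Finset (Fin (2 * n))) :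
    pderivC i H s = MvPolynomial.pderiv i (H s) := rfl

lemma pderivC_comm (i j : Fin m) (H : PG m n) :
    pderivC i (pderivC j H) = pderivC j (pderivC i H) := by
  ext1 s
  exact pderiv_comm i j (H s)

lemma pderivC_pderivL (i : Fin m) (t : Fin (2 * n)) (H : PG m n) :
    pderivC i (pderivL t H) = pderivL t (pderivC i H) := mapC_pderivL _ _ _

lemma superLapP_eq (H : PG m n) :
    superLapP m n H =
      4 • ∑ j, pderivL (lo n j) (pderivL (hi n j) H) - ∑ i, pderivC i (pderivC i H) := by
  ext1 s
  simp only [superLapP, Pi.sub_apply, Pi.smul_apply, Finset.sum_apply]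
  rw [nsmul_eq_mul]
  rfl

lemma superLapP_pderivC (i : Fin m) (H : PG m n) :
    superLapP m n (pderivC i H) = pderivC i (superLapP m n H) := by
  simp only [superLapP_eq, map_sub, map_nsmul, map_sum, pderivC_pderivL]
  simp only [pderivC_comm _ i]

lemma superLapP_pderivL (t : Fin (2 * n)) (H : PG m n) :
    superLapP m n (pderivL t H) = pderivL t (superLapP m n H) := by
  simp only [superLapP_eq, map_sub, map_nsmul, map_sum, pderivC_pderivL, pderivL_comm_pair t]

namespace PHomog

variable {l : ℕ} {H : PG m n}

lemma pderivC (h : PHomog m n H (l + 1)) (i : Fin m) : PHomog m n (pderivC i H) l := by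
  classical
  intro s d hd
  rw [mem_support_iff, pderivC_apply, coeff_pderiv] at hd
  have := h s (d + Finsupp.single i 1) (mem_support_iff.2 (left_ne_zero_of_mul hd))
  rw [Finsupp.sum_add_index' (by simp) (by simp), Finsupp.sum_single_index rfl] at this
  omega

lemma pderivL (h : PHomog m n H (l + 1)) (t : Fin (2 * n)) : PHomog m n (pderivL t H) l := by
  intro s d hd
  rw [mem_support_iff, pderivL_apply] at hd
  split_ifs at hd with ht
  · simp at hd
  · have := h (insert t s) d (mem_support_iff.2 fun h0 => hd ?_)
    · rw [Finset.card_insert_of_notMem ht] at this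
      omega
    · have : (C ((-1 : ℂ) ^ ((s.filter fun i => i < t).card)) : MvPolynomial (Fin m) ℂ) =
          sgn (MvPolynomial (Fin m) ℂ) t s := by simp [sgn]
      rw [← this, coeff_C_mul, h0, mul_zero]

/-- Euler's identity. -/
lemma euler (h : PHomog m n H l) :
    l • H = ∑ i, (X i : MvPolynomial (Fin m) ℂ) • _root_.pderivC i H +
      ∑ t, genL t (Gr.pderivL t H) := by
  ext1 s
  simp only [Pi.add_apply, Finset.sum_apply, Pi.smul_apply, smul_eq_mul, pderivC_apply]
  have h1 := sum_genL_pderivL_apply H s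
  rw [Finset.sum_apply] at h1
  rw [h1]
  by_cases hs : H s = 0
  · simp [hs]
  · obtain ⟨d, hd⟩ := Finset.nonempty_iff_ne_empty.2 (mt support_eq_empty.1 hs)
    have hle := h s d hd
    have hh : (H s).IsHomogeneous (l - s.card) := by
      intro e he
      have hd : e.degree + s.card = l := h s e (mem_support_iff.2 he)
      rw [Pi.one_def, ← Finsupp.degree_eq_weight_one]
      omega
    rw [hh.sum_X_mul_pderiv, ← nsmul_eq_mul, ← add_nsmul]
    congr 1
    omega

lemma apply_of_ne_empty (h : PHomog m n H 0) {s : Finset (Fin (2 * n))} (hs : s ≠ ∅) :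
    H s = 0 := by
  by_contra h0
  obtain ⟨d, hd⟩ := Finset.nonempty_iff_ne_empty.2 (mt support_eq_empty.1 h0)
  have := h s d hd
  have := Finset.card_pos.2 (Finset.nonempty_iff_ne_empty.2 hs)
  omega

lemma exists_apply_empty (h : PHomog m n H 0) : ∃ a : ℂ, H ∅ = C a := by
  refine ⟨coeff 0 (H ∅), ?_⟩
  refine totalDegree_eq_zero_iff_eq_C.1 ?_
  refine Nat.le_zero.1 (Finset.sup_le fun d hd => ?_)
  have := h ∅ d hd
  omega

end PHomog

/-- Coefficientwise Gaussian integration. -/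
noncomputable def gaussC {c : Fin m → ℂ} (hc : ∀ i, (c i).re = 0) : PG m n →+ Gr ℂ (2 * n) :=
  mapC (gaussFunctionalL hc).toAddMonoidHom

lemma gaussC_X_smul {c : Fin m → ℂ} (hc : ∀ i, (c i).re = 0) (i : Fin m) (H : PG m n) :
    gaussC hc ((X i : MvPolynomial (Fin m) ℂ) • H) =
      c i • gaussC hc H + gaussC hc (pderivC i H) := by
  ext1 s
  exact gaussFunctional_X_mul hc i (H s)

/-- Evaluation at a point as an additive map. -/
noncomputable def evalC (y : Fin m → ℝ) : PG m n →+ Gr ℂ (2 * n) :=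
  mapC (eval fun i => (y i : ℂ)).toAddMonoidHom

lemma evalC_apply (y : Fin m → ℝ) (H : PG m n) : evalC y H = evalP m n H y := rfl

lemma evalC_X_smul (y : Fin m → ℝ) (i : Fin m) (H : PG m n) :
    evalC y ((X i : MvPolynomial (Fin m) ℂ) • H) = (y i : ℂ) • evalC y H := by
  ext1 s
  change eval _ (X i * H s) = _
  rw [map_mul, eval_X]; rfl

lemma sum_fermFTGauss_genL (σ : ℂ) (f : Fin (2 * n) → Gr ℂ (2 * n)) :
    ∑ t, fermFTGauss n σ (genL t (f t)) =
      (σ * Complex.I) • ∑ t, genL t (fermFTGauss n σ (f t)) +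
        2 • ∑ j, (fermFTGauss n σ (pderivL (hi n j) (f (lo n j))) -
          fermFTGauss n σ (pderivL (lo n j) (f (hi n j)))) := by
  rw [sum_lo_hi, sum_lo_hi, Finset.smul_sum, Finset.smul_sum, ← Finset.sum_add_distrib]
  refine Finset.sum_congr rfl fun j _ => ?_
  rw [fermFTGauss_genL_lo, fermFTGauss_genL_hi]
  module

lemma fermFTGauss_gaussC {σ : ℂ} (hσ : σ * σ = 1) (y : Fin m → ℝ)
    (hc : ∀ i, (σ * Complex.I * y i).re = 0) (l : ℕ) (H : PG m n) (hhom : PHomog m n H l)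
    (hharm : superLapP m n H = 0) :
    fermFTGauss n σ (gaussC hc H) = (σ * Complex.I) ^ l • mulL (fermGauss n) (evalC y H) := by
  induction l generalizing H with
  | zero =>
    obtain ⟨a, ha⟩ := hhom.exists_apply_empty
    have h1 : gaussC hc H = a • one := by
      ext1 s
      by_cases hs : s = ∅
      · subst hs
        have h2 := gaussFunctional_C_mul (fun i => σ * Complex.I * y i) a 1
        rw [mul_one, gaussFunctional_one] at h2
        change gaussFunctional _ (H ∅) = _
        rw [ha, h2]; simp [one]
      · change gaussFunctionalL hc (H s) = _
        rw [hhom.apply_of_ne_empty hs, map_zero]; simp [one, hs]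
    have h2 : evalC y H = a • one := by
      ext1 s
      by_cases hs : s = ∅
      · subst hs
        change eval _ (H ∅) = _
        rw [ha]; simp [one]
      · change eval _ (H s) = _
        rw [hhom.apply_of_ne_empty hs, map_zero]; simp [one, hs]
    rw [h1, h2, map_smul, map_smul, fermFTGauss_one hσ, mulL_apply, mul_one', pow_zero, one_smul]
  | succ l ih =>
    have ihC := fun i => ih (pderivC i H) (hhom.pderivC i)
      (by rw [superLapP_pderivC, hharm, map_zero])
    have ihL := fun t => ih (pderivL t H) (hhom.pderivL t)
      (by rw [superLapP_pderivL, hharm, map_zero])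
    have hE := congrArg (fun G => fermFTGauss n σ (gaussC hc G)) hhom.euler
    have hV := congrArg (fun G => mulL (fermGauss n) (evalC y G)) hhom.euler
    have hL := congrArg (fun G => fermFTGauss n σ (gaussC hc G)) hharm
    have hcL : ∀ t (G : PG m n), gaussC hc (pderivL t G) = pderivL t (gaussC hc G) :=
      fun t G => mapC_pderivL _ _ _
    simp only [superLapP_eq, map_sub, map_nsmul, map_sum, map_zero] at hL
    have hcG : ∀ t (G : PG m n), gaussC hc (genL t G) = genL t (gaussC hc G) :=
      fun t G => mapC_genL _ _ _
    have hvG : ∀ t (G : PG m n), evalC y (genL t G) = genL t (evalC y G) :=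
      fun t G => mapC_genL _ _ _
    simp only [map_nsmul, map_add, map_sum, gaussC_X_smul, hcG, map_smul,
      sum_fermFTGauss_genL, ihC, ihL, Finset.sum_add_distrib, ← hcL] at hE
    simp only [map_nsmul, map_add, map_sum, evalC_X_smul, hvG, map_smul] at hV
    have hanti : ∀ j, fermFTGauss n σ (gaussC hc (pderivL (hi n j) (pderivL (lo n j) H))) =
        -fermFTGauss n σ (gaussC hc (pderivL (lo n j) (pderivL (hi n j) H))) := by
      intro j
      rw [pderivL_pderivL (lo_ne_hi j j).symm, map_neg, map_neg]
    simp only [hanti] at hE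
    have h0 : ((l + 1 : ℕ) : ℂ) ≠ 0 := Nat.cast_ne_zero.2 l.succ_ne_zero
    refine smul_right_injective _ h0 ?_
    simp only [Nat.cast_smul_eq_nsmul]
    rw [smul_comm, hE, hV]
    have e1 : ∑ i, (σ * Complex.I * y i) • (σ * Complex.I) ^ l •
          mulL (fermGauss n) (evalC y (pderivC i H)) =
        (σ * Complex.I) ^ (l + 1) •
          ∑ i, (y i : ℂ) • mulL (fermGauss n) (evalC y (pderivC i H)) := by
      rw [Finset.smul_sum]
      refine Finset.sum_congr rfl fun i _ => ?_
      module
    have e2 : ∑ t, (σ * Complex.I) ^ l • genL t (mulL (fermGauss n) (evalC y (pderivL t H))) =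
        (σ * Complex.I) ^ l •
          ∑ t, mulL (fermGauss n) (genL t (evalC y (pderivL t H))) := by
      rw [Finset.smul_sum]
      simp only [genL_fermGauss]
    rw [e1, e2, Finset.sum_sub_distrib, Finset.sum_neg_distrib]
    linear_combination (norm := module) (-1 : ℂ) • hL

lemma gaussWeight_eq (σ : ℂ) (x y : Fin m → ℝ) :
    gaussWeight (fun i => σ * Complex.I * y i) x =
      Complex.exp (σ * Complex.I * ∑ i, (x i : ℂ) * (y i : ℂ)) *
        ((Real.exp (-(∑ i, (x i) ^ 2) / 2) : ℝ) : ℂ) := by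
  rw [gaussWeight, Complex.ofReal_exp, ← Complex.exp_add, Finset.mul_sum (a := σ * Complex.I)]
  congr 1
  push_cast
  rw [add_comm]
  congr 1
  · exact Finset.sum_congr rfl fun i _ => by ring
  · ring

lemma mul_gaussFun (H : PG m n) (x : Fin m → ℝ) :
    mul (evalP m n H x) (gaussFun m n x) =
      ((Real.exp (-(∑ i, (x i) ^ 2) / 2) : ℝ) : ℂ) • mulL (fermGauss n) (evalP m n H x) := by
  rw [gaussFun, ← mulL_apply, map_smul, mulL_apply, mul_fermGauss]

lemma integral_gaussWeight_smul {c : Fin m → ℂ} (hc : ∀ i, (c i).re = 0)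
    (Λ : Gr ℂ (2 * n) →ₗ[ℂ] ℂ) (H : PG m n) :
    ((2 * Real.pi : ℝ) : ℂ) ^ (-(m : ℂ) / 2) * Complex.exp (-(∑ i, c i ^ 2) / 2) *
        ∫ x : Fin m → ℝ, gaussWeight c x * Λ (evalP m n H x) = Λ (gaussC hc H) := by
  have h : ∀ g : Gr ℂ (2 * n), Λ g = ∑ A, g A * Λ (Pi.single A 1) := by
    intro g
    conv_lhs => rw [← Finset.univ_sum_single g, map_sum]
    refine Finset.sum_congr rfl fun A _ => ?_
    have hA : Pi.single A (g A) = g A • (Pi.single A 1 : Gr ℂ (2 * n)) := by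
      rw [← Pi.single_smul, smul_eq_mul, mul_one]
    rw [hA, map_smul, smul_eq_mul]
  have h1 : ∀ x : Fin m → ℝ, gaussWeight c x * Λ (evalP m n H x) =
      ∑ A, (eval (fun i => (x i : ℂ)) (H A) * gaussWeight c x) * Λ (Pi.single A 1) := by
    intro x
    rw [h, Finset.mul_sum]
    refine Finset.sum_congr rfl fun A _ => ?_
    rw [evalP]; ring
  simp only [h1]
  rw [integral_finsetSum _ fun A _ => (integrable_eval_mul_gaussWeight hc _).mul_const _,
    h (gaussC hc H), Finset.mul_sum]
  refine Finset.sum_congr rfl fun A _ => ?_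
  rw [integral_mul_const, ← mul_assoc]
  rfl

lemma superFT_mul_gaussFun {σ : ℂ} (hσ : σ * σ = 1) (H : PG m n) (y : Fin m → ℝ)
    (hc : ∀ i, (σ * Complex.I * y i).re = 0) :
    superFT m n σ (fun x => mul (evalP m n H x) (gaussFun m n x)) y =
      ((Real.exp (-(∑ i, (y i) ^ 2) / 2) : ℝ) : ℂ) • fermFTGauss n σ (gaussC hc H) := by
  ext1 s
  have hpi : ((2 * Real.pi : ℝ) : ℂ) ≠ 0 := by
    exact_mod_cast (by positivity : (2 * Real.pi : ℝ) ≠ 0)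
  have hpi' : (Real.pi : ℂ) ≠ 0 := by exact_mod_cast Real.pi_ne_zero
  have hpow : ((2 * Real.pi : ℝ) : ℂ) ^ (-((m : ℂ) - 2 * (n : ℂ)) / 2) =
      ((2 * Real.pi : ℝ) : ℂ) ^ (-(m : ℂ) / 2) * ((2 : ℂ) ^ n * (Real.pi : ℂ) ^ n) := by
    rw [show -((m : ℂ) - 2 * (n : ℂ)) / 2 = -(m : ℂ) / 2 + n by ring, Complex.cpow_add _ _ hpi,
      Complex.cpow_natCast, ← mul_pow]
    push_cast; rfl
  have hker : ∀ x : Fin m → ℝ, Complex.exp (σ * Complex.I * ∑ i, (x i : ℂ) * (y i : ℂ)) *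
      berezinX n (mul (fermK n σ) (embX n (mul (evalP m n H x) (gaussFun m n x))))
        (s.image (yi n)) = ((2 : ℂ) ^ n * (Real.pi : ℂ) ^ n)⁻¹ *
      (gaussWeight (fun i => σ * Complex.I * y i) x *
        (LinearMap.proj s ∘ₗ fermFTGauss n σ : Gr ℂ (2 * n) →ₗ[ℂ] ℂ) (evalP m n H x)) := by
    intro x
    rw [berezinX_image, mul_gaussFun, gaussWeight_eq, ← embXL_apply, map_smul, ← mulL_apply,
      map_smul, map_smul, LinearMap.comp_apply, fermFTGauss_apply, LinearMap.proj_apply,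
      Pi.smul_apply, Pi.smul_apply, smul_eq_mul, smul_eq_mul, mulL_apply (fermK n σ), mul_inv]
    field_simp
  have hexp : Complex.exp (-(∑ i, (σ * Complex.I * y i) ^ 2) / 2) *
      ((Real.exp (-(∑ i, (y i) ^ 2) / 2) : ℝ) : ℂ) = 1 := by
    rw [Complex.ofReal_exp, ← Complex.exp_add]
    have : ∀ i, (σ * Complex.I * y i) ^ 2 = -(y i : ℂ) ^ 2 := fun i => by
      linear_combination (Complex.I * y i) ^ 2 * hσ + (y i : ℂ) ^ 2 * Complex.I_sq
    simp only [this, Finset.sum_neg_distrib]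
    push_cast
    rw [← Complex.exp_zero]
    congr 1
    ring
  have hmain := integral_gaussWeight_smul hc (LinearMap.proj s ∘ₗ fermFTGauss n σ) H
  rw [LinearMap.comp_apply, LinearMap.proj_apply] at hmain
  simp only [superFT, hker, Pi.smul_apply, smul_eq_mul]
  rw [integral_const_mul, ← hmain, hpow]
  have h2 : ((2 : ℂ) ^ n * (Real.pi : ℂ) ^ n) * ((2 : ℂ) ^ n * (Real.pi : ℂ) ^ n)⁻¹ = 1 :=
    mul_inv_cancel₀ (mul_ne_zero (pow_ne_zero _ two_ne_zero) (pow_ne_zero _ hpi'))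
  set J : ℂ := ∫ x : Fin m → ℝ, gaussWeight (fun i => σ * Complex.I * y i) x *
    (LinearMap.proj s ∘ₗ fermFTGauss n σ : Gr ℂ (2 * n) →ₗ[ℂ] ℂ) (evalP m n H x)
  linear_combination ((2 * Real.pi : ℝ) : ℂ) ^ (-(m : ℂ) / 2) * J * (h2 - hexp)

end SphericalHarmonics

/-- Let `H ∈ ℂ[x_1,…,x_m] ⊗ Λ_{2n}` be a super spherical harmonic of degree `l`
(homogeneous of total degree `l` and annihilated by the super Laplace operator).  Then
`F^±_{m|2n}(H(x) exp(x²/2))(y) = (±i)^l H(y) exp(y²/2)` (sign `σ = ±1`). -/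
theorem superFT_spherical_harmonic (m n l : ℕ) (hm : 1 ≤ m) (σ : ℂ)
    (hσ : σ = 1 ∨ σ = -1) (H : PG m n) (hhom : PHomog m n H l)
    (hharm : superLapP m n H = 0) :
    superFT m n σ (fun x => Gr.mul (evalP m n H x) (gaussFun m n x)) =
      fun y => (σ * Complex.I) ^ l • Gr.mul (evalP m n H y) (gaussFun m n y) := by
  have hσ2 : σ * σ = 1 := by rcases hσ with rfl | rfl <;> norm_num
  funext y
  have hc : ∀ i, (σ * Complex.I * (y i : ℂ)).re = 0 := fun i => by
    rcases hσ with rfl | rfl <;> simp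
  rw [superFT_mul_gaussFun hσ2 H y hc, fermFTGauss_gaussC hσ2 y hc l H hhom hharm,
    mul_gaussFun, smul_comm, evalC_apply]
end

section
/- Let m ≥ 1, n ≥ 0 and let j, k, l be integers with 0 ≤ j ≤ n, k ≥ 0, l ≥ 2k + j and k + j ≤ n. Then the following identity of polynomials in two commuting indeterminates u, v holds: Σ_{i=0}^{k} C(k,i) · ((n−j−i)!/Γ(m/2 + l − k − j − i)) · H^b_{k−i, l−2k−j}(u) · H^f_{i, j}(v) = Σ_{i=0}^{k} C(k,i) · ((n−j−i)!/Γ(m/2 + l − k − j − i)) · u^{k−i} · v^{i}, where H^b_{t,p}(u) = Σ_{i=0}^{t} 2^{2t−2i} C(t,i) (Γ(t + p + m/2)/Γ(i + p + m/2)) u^i and H^f_{t,q}(v) = Σ_{i=0}^{t} (−1)^{t−i} 2^{2t−2i} C(t,i) ((n−q−i)!/(n−q−t)!) v^i. -/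
open scoped BigOperators

noncomputable section

/-- The explicit form of the rescaled Clifford–Hermite polynomial of even degree `2t`
attached to degree `p` in super-dimension `M = m`:
`H^b_{t,p}(u) = Σ_{i=0}^t 2^{2t-2i} C(t,i) (Γ(t+p+m/2)/Γ(i+p+m/2)) u^i`,
regarded as a polynomial in the commuting indeterminate `u = X 0`. -/
def Hb (m t p : ℕ) : MvPolynomial (Fin 2) ℝ :=
  ∑ i ∈ Finset.range (t + 1),
    MvPolynomial.C ((2 : ℝ) ^ (2 * t - 2 * i) * (t.choose i : ℝ) *
        Real.Gamma ((t : ℝ) + p + m / 2) / Real.Gamma ((i : ℝ) + p + m / 2)) *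
      MvPolynomial.X 0 ^ i

/-- The explicit form of the rescaled Clifford–Hermite polynomial of even degree `2t`
attached to degree `q` in super-dimension `M = -2n`:
`H^f_{t,q}(v) = Σ_{i=0}^t (-1)^{t-i} 2^{2t-2i} C(t,i) ((n-q-i)!/(n-q-t)!) v^i`,
regarded as a polynomial in the commuting indeterminate `v = X 1`. -/
def Hf (n t q : ℕ) : MvPolynomial (Fin 2) ℝ :=
  ∑ i ∈ Finset.range (t + 1),
    MvPolynomial.C ((-1 : ℝ) ^ (t - i) * (2 : ℝ) ^ (2 * t - 2 * i) * (t.choose i : ℝ) *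
        ((n - q - i).factorial : ℝ) / ((n - q - t).factorial : ℝ)) *
      MvPolynomial.X 1 ^ i

/-- The linear map on real polynomials in two indeterminates that rescales the monomial
`X 0 ^ a * X 1 ^ b` by the factor `w a * z b`. -/
def monomialRescale (w z : ℕ → ℝ) : MvPolynomial (Fin 2) ℝ →ₗ[ℝ] MvPolynomial (Fin 2) ℝ :=
  (MvPolynomial.basisMonomials (Fin 2) ℝ).constr ℝ fun s =>
    MvPolynomial.monomial s (w (s 0) * z (s 1))

theorem C_mul_X_zero_pow_mul_C_mul_X_one_pow (r s : ℝ) (a b : ℕ) :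
    (MvPolynomial.C r * MvPolynomial.X 0 ^ a) * (MvPolynomial.C s * MvPolynomial.X 1 ^ b) =
      MvPolynomial.monomial (Finsupp.single (0 : Fin 2) a + Finsupp.single 1 b) (r * s) := by
  rw [MvPolynomial.C_mul_X_pow_eq_monomial, MvPolynomial.C_mul_X_pow_eq_monomial,
    MvPolynomial.monomial_mul]

theorem monomialRescale_monomial (w z : ℕ → ℝ) (s : Fin 2 →₀ ℕ) (r : ℝ) :
    monomialRescale w z (MvPolynomial.monomial s r) =
      MvPolynomial.monomial s (r * (w (s 0) * z (s 1))) := by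
  have h : MvPolynomial.monomial s r = r • MvPolynomial.basisMonomials (Fin 2) ℝ s := by
    simp [MvPolynomial.smul_monomial]
  rw [h, map_smul, monomialRescale, Module.Basis.constr_basis, MvPolynomial.smul_monomial,
    smul_eq_mul]

theorem monomialRescale_C_mul_pow_mul (w z : ℕ → ℝ) (r s : ℝ) (a b : ℕ) :
    monomialRescale w z
        ((MvPolynomial.C r * MvPolynomial.X 0 ^ a) * (MvPolynomial.C s * MvPolynomial.X 1 ^ b)) =
      (MvPolynomial.C (r * w a) * MvPolynomial.X 0 ^ a) *
        (MvPolynomial.C (s * z b) * MvPolynomial.X 1 ^ b) := by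
  rw [C_mul_X_zero_pow_mul_C_mul_X_one_pow, C_mul_X_zero_pow_mul_C_mul_X_one_pow,
    monomialRescale_monomial]
  congr 1
  simp
  ring

theorem monomialRescale_sum_mul_sum (w z α β : ℕ → ℝ) (A B : Finset ℕ) :
    monomialRescale w z
        ((∑ a ∈ A, MvPolynomial.C (α a) * MvPolynomial.X 0 ^ a) *
          ∑ b ∈ B, MvPolynomial.C (β b) * MvPolynomial.X 1 ^ b) =
      (∑ a ∈ A, MvPolynomial.C (α a * w a) * MvPolynomial.X 0 ^ a) *
        ∑ b ∈ B, MvPolynomial.C (β b * z b) * MvPolynomial.X 1 ^ b := by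
  simp only [Finset.sum_mul_sum, map_sum, monomialRescale_C_mul_pow_mul]

theorem X_add_C_pow (x : Fin 2) (r : ℝ) (t : ℕ) :
    (MvPolynomial.X x + MvPolynomial.C r : MvPolynomial (Fin 2) ℝ) ^ t =
      ∑ a ∈ Finset.range (t + 1),
        MvPolynomial.C (r ^ (t - a) * (t.choose a : ℝ)) * MvPolynomial.X x ^ a := by
  rw [add_pow]
  refine Finset.sum_congr rfl fun a _ => ?_
  simp only [map_mul, map_pow, map_natCast]
  ring

theorem Hb_eq_C_mul_sum (m t p : ℕ) :
    Hb m t p = MvPolynomial.C (Real.Gamma ((t : ℝ) + p + m / 2)) *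
      ∑ a ∈ Finset.range (t + 1), MvPolynomial.C (4 ^ (t - a) * (t.choose a : ℝ) *
        (Real.Gamma ((a : ℝ) + p + m / 2))⁻¹) * MvPolynomial.X 0 ^ a := by
  rw [Hb, Finset.mul_sum]
  refine Finset.sum_congr rfl fun a _ => ?_
  rw [← mul_assoc, ← MvPolynomial.C_mul, ← Nat.mul_sub, pow_mul]
  congr 2
  norm_num
  ring

theorem Hf_eq_C_mul_sum (n t q : ℕ) :
    Hf n t q = MvPolynomial.C ((n - q - t).factorial : ℝ)⁻¹ *
      ∑ b ∈ Finset.range (t + 1), MvPolynomial.C ((-4) ^ (t - b) * (t.choose b : ℝ) *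
        ((n - q - b).factorial : ℝ)) * MvPolynomial.X 1 ^ b := by
  rw [Hf, Finset.mul_sum]
  refine Finset.sum_congr rfl fun b _ => ?_
  rw [← mul_assoc, ← MvPolynomial.C_mul, ← Nat.mul_sub, pow_mul, ← mul_pow]
  congr 2
  norm_num
  ring

/-- For `m ≥ 1`, `0 ≤ j ≤ n`, `k ≥ 0`, `l ≥ 2k + j` and `k + j ≤ n`, the identity of
polynomials in the two commuting indeterminates `u = X 0`, `v = X 1`:
`Σ_{i=0}^k C(k,i) ((n-j-i)!/Γ(m/2+l-k-j-i)) H^b_{k-i,l-2k-j}(u) H^f_{i,j}(v)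
  = Σ_{i=0}^k C(k,i) ((n-j-i)!/Γ(m/2+l-k-j-i)) u^{k-i} v^i`. -/
theorem hermite_product_identity (m n j k l : ℕ) (hm : 1 ≤ m) (hj : j ≤ n)
    (hl : 2 * k + j ≤ l) (hkj : k + j ≤ n) :
    (∑ i ∈ Finset.range (k + 1),
        MvPolynomial.C ((k.choose i : ℝ) * ((n - j - i).factorial : ℝ) /
            Real.Gamma ((m : ℝ) / 2 + l - k - j - i)) *
          Hb m (k - i) (l - 2 * k - j) * Hf n i j) =
      ∑ i ∈ Finset.range (k + 1),
        MvPolynomial.C ((k.choose i : ℝ) * ((n - j - i).factorial : ℝ) /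
            Real.Gamma ((m : ℝ) / 2 + l - k - j - i)) *
          MvPolynomial.X 0 ^ (k - i) * MvPolynomial.X 1 ^ i := by
  set p := l - 2 * k - j with hp
  have hpl : (l : ℝ) = p + 2 * k + j := by
    have : l = p + 2 * k + j := by omega
    exact_mod_cast this
  let w : ℕ → ℝ := fun a => (Real.Gamma ((a : ℝ) + p + m / 2))⁻¹
  let z : ℕ → ℝ := fun b => ((n - j - b).factorial : ℝ)
  have hG (i : ℕ) (hi : i ∈ Finset.range (k + 1)) :
      Real.Gamma ((m : ℝ) / 2 + l - k - j - i) =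
        Real.Gamma (((k - i : ℕ) : ℝ) + p + m / 2) := by
    rw [Nat.cast_sub (Finset.mem_range_succ_iff.mp hi), hpl]
    congr 1
    ring
  have hG_ne (a : ℕ) : Real.Gamma ((a : ℝ) + p + m / 2) ≠ 0 := by
    have : (0 : ℝ) < m := by exact_mod_cast hm
    exact (Real.Gamma_pos_of_pos (by positivity)).ne'
  have key : (∑ i ∈ Finset.range (k + 1), (k.choose i : ℝ) •
        ((MvPolynomial.X 0 + MvPolynomial.C (4 : ℝ) : MvPolynomial (Fin 2) ℝ) ^ (k - i) *
          (MvPolynomial.X 1 + MvPolynomial.C (-4 : ℝ)) ^ i)) =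
      ∑ i ∈ Finset.range (k + 1), (k.choose i : ℝ) •
        ((MvPolynomial.C 1 * MvPolynomial.X 0 ^ (k - i)) *
          (MvPolynomial.C 1 * MvPolynomial.X 1 ^ i)) := by
    have binomial (x y : MvPolynomial (Fin 2) ℝ) :
        ∑ i ∈ Finset.range (k + 1), (k.choose i : ℝ) • (x ^ (k - i) * y ^ i) = (y + x) ^ k := by
      rw [add_pow]
      refine Finset.sum_congr rfl fun i _ => ?_
      rw [MvPolynomial.smul_eq_C_mul, map_natCast]
      ring
    simp only [MvPolynomial.C_1, one_mul, binomial]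
    congr 1
    rw [MvPolynomial.C_neg]
    ring
  have := congrArg (monomialRescale w z) key
  simp only [map_sum, map_smul, X_add_C_pow, monomialRescale_sum_mul_sum,
    monomialRescale_C_mul_pow_mul] at this
  convert this using 1
  · refine Finset.sum_congr rfl fun i hi => ?_
    rw [hG i hi, Hb_eq_C_mul_sum, Hf_eq_C_mul_sum, MvPolynomial.smul_eq_C_mul]
    have hc : (k.choose i : ℝ) = (k.choose i : ℝ) * ((n - j - i).factorial : ℝ) /
        Real.Gamma (((k - i : ℕ) : ℝ) + p + m / 2) *
        Real.Gamma (((k - i : ℕ) : ℝ) + p + m / 2) * ((n - j - i).factorial : ℝ)⁻¹ := by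
      have := hG_ne (k - i)
      field_simp
    conv_rhs => rw [hc]
    simp only [MvPolynomial.C_mul (a' := ((n - j - i).factorial : ℝ)⁻¹),
      MvPolynomial.C_mul (a' := Real.Gamma (((k - i : ℕ) : ℝ) + p + m / 2))]
    ring
  · refine Finset.sum_congr rfl fun i hi => ?_
    rw [hG i hi, MvPolynomial.smul_eq_C_mul, div_eq_mul_inv, MvPolynomial.C_mul,
      MvPolynomial.C_mul, one_mul, one_mul]
    ring

end
end

section
/- For all natural numbers k, p, q with p + q ≤ k, the alternating sum Σ_{i=q}^{k−p} (−1)^i C(k,i) C(k−i,p) C(i,q) equals (−1)^q C(k,p) if k = p + q, and equals 0 if p + q < k. -/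
open scoped BigOperators

theorem Nat.choose_mul_choose_sub_mul_choose (p q n j : ℕ) (hj : j ≤ n) :
    (p + q + n).choose (q + j) * (p + q + n - (q + j)).choose p * (q + j).choose q =
      (p + q + n).choose q * (p + n).choose p * n.choose j := by
  have h₁ := Nat.choose_mul (n := p + q + n) (Nat.le_add_right q j)
  have h₂ := Nat.choose_mul (n := p + n) (k := p + n - j) (s := p) (by omega)
  rw [Nat.choose_symm (by omega), show p + n - p = n by omega,
    show p + n - j - p = n - j by omega, Nat.choose_symm hj] at h₂
  rw [show p + q + n - q = p + n by omega, show q + j - q = j by omega] at h₁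
  rw [show p + q + n - (q + j) = p + n - j by omega, mul_right_comm, h₁, mul_assoc, h₂,
    mul_assoc]

theorem Int.alternating_sum_choose_mul_choose_sub_mul_choose (p q n : ℕ) :
    (∑ i ∈ Finset.Icc q (q + n), (-1 : ℤ) ^ i * ((p + q + n).choose i) *
        ((p + q + n - i).choose p) * (i.choose q)) =
      (-1) ^ q * (p + q + n).choose q * (p + n).choose p * if n = 0 then 1 else 0 := by
  rw [← Int.alternating_sum_range_choose, Finset.mul_sum, ← Finset.Ico_add_one_right_eq_Icc,
    Finset.sum_Ico_eq_sum_range, show q + n + 1 - q = n + 1 by omega]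
  refine Finset.sum_congr rfl fun j hj ↦ ?_
  have h := congrArg (Nat.cast : ℕ → ℤ) (Nat.choose_mul_choose_sub_mul_choose p q n j
    (Finset.mem_range_succ_iff.mp hj))
  push_cast at h
  rw [pow_add]
  linear_combination (-1 : ℤ) ^ q * (-1) ^ j * h

/-- For all natural numbers `k, p, q` with `p + q ≤ k`, the alternating sum
`Σ_{i=q}^{k-p} (-1)^i C(k,i) C(k-i,p) C(i,q)` equals `(-1)^q C(k,p)` if `k = p + q`
and equals `0` if `p + q < k`. -/
theorem alternating_binomial_sum (k p q : ℕ) (h : p + q ≤ k) :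
    (k = p + q →
      (∑ i ∈ Finset.Icc q (k - p),
          (-1 : ℤ) ^ i * (k.choose i) * ((k - i).choose p) * (i.choose q)) =
        (-1 : ℤ) ^ q * (k.choose p)) ∧
    (p + q < k →
      (∑ i ∈ Finset.Icc q (k - p),
          (-1 : ℤ) ^ i * (k.choose i) * ((k - i).choose p) * (i.choose q)) = 0) := by
  obtain ⟨n, rfl⟩ := Nat.exists_eq_add_of_le h
  rw [show p + q + n - p = q + n by omega,
    Int.alternating_sum_choose_mul_choose_sub_mul_choose]
  refine ⟨fun hn ↦ ?_, fun hn ↦ ?_⟩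
  · obtain rfl : n = 0 := by omega
    simp [← Nat.choose_symm_add (a := p) (b := q)]
  · simp [show n ≠ 0 by omega]
end
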